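/- arXiv:2012.06817 — 8 statements merged into one kernel-verified Lean document; each statement's English description precedes it below -/
import Mathlib

section
/- Let d ≥ 1. For every t > 0 and every Borel measurable V : ℝ^d → ℝ one has r_*(V, t/2) ≤ (4π)^{-d/2} ‖N(V,t)‖_∞ ≤ 2 · r_*(V, t/2). -/
open MeasureTheory Filter
open scoped ENNReal

/-- The Gauss-Weierstrass kernel on `ℝ^d`. -/
noncomputable def gauss (d : ℕ) (t : ℝ) (x y : EuclideanSpace ℝ (Fin d)) : ℝ :=
  (4 * Real.pi * t) ^ (-(d : ℝ) / 2) * Real.exp (-‖y - x‖ ^ 2 / (4 * t))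

/-- `S(V,t,x,y)`. -/
noncomputable def Sk (d : ℕ) (V : EuclideanSpace ℝ (Fin d) → ℝ) (t : ℝ)
    (x y : EuclideanSpace ℝ (Fin d)) : ℝ≥0∞ :=
  ∫⁻ s in Set.Ioo (0 : ℝ) t, ∫⁻ z,
    ENNReal.ofReal (gauss d s x z * gauss d (t - s) z y / gauss d t x y * |V z|)

/-- `‖S(V,t)‖_∞`. -/
noncomputable def SNorm (d : ℕ) (V : EuclideanSpace ℝ (Fin d) → ℝ) (t : ℝ) : ℝ≥0∞ :=
  ⨆ x, ⨆ y, Sk d V t x y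

/-- `‖S(V)‖_{T,∞}`. -/
noncomputable def SNormT (d : ℕ) (V : EuclideanSpace ℝ (Fin d) → ℝ) (T : ℝ) : ℝ≥0∞ :=
  ⨆ t ∈ Set.Ioc (0 : ℝ) T, SNorm d V t

/-- `sup_x ∫_0^t ∫ g(s,x,z)|V(z)| dz ds`. -/
noncomputable def katoA (d : ℕ) (V : EuclideanSpace ℝ (Fin d) → ℝ) (t : ℝ) : ℝ≥0∞ :=
  ⨆ x, ∫⁻ s in Set.Ioo (0 : ℝ) t, ∫⁻ z, ENNReal.ofReal (gauss d s x z * |V z|)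

/-- The kernel `p_α(t,x,y) = g(t, x - 2αt, y)`. -/
noncomputable def pk (d : ℕ) (α : EuclideanSpace ℝ (Fin d)) (t : ℝ)
    (x y : EuclideanSpace ℝ (Fin d)) : ℝ :=
  gauss d t (x - (2 * t) • α) y

/-- `N(V,t,x,y)`. -/
noncomputable def Nk (d : ℕ) (V : EuclideanSpace ℝ (Fin d) → ℝ) (t : ℝ)
    (x y : EuclideanSpace ℝ (Fin d)) : ℝ≥0∞ :=
  (∫⁻ τ in Set.Ioo (0 : ℝ) (t / 2), ∫⁻ z, ENNReal.ofReal
      (τ ^ (-(d : ℝ) / 2) * Real.exp (-‖z - y + (τ / t) • (y - x)‖ ^ 2 / (4 * τ)) * |V z|)) +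
  (∫⁻ τ in Set.Ioo (t / 2) t, ∫⁻ z, ENNReal.ofReal
      ((t - τ) ^ (-(d : ℝ) / 2) *
        Real.exp (-‖z - y + (τ / t) • (y - x)‖ ^ 2 / (4 * (t - τ))) * |V z|))

/-- `‖N(V,t)‖_∞`. -/
noncomputable def NNorm (d : ℕ) (V : EuclideanSpace ℝ (Fin d) → ℝ) (t : ℝ) : ℝ≥0∞ :=
  ⨆ x, ⨆ y, Nk d V t x y

/-- `‖N(V)‖_{T,∞}`. -/
noncomputable def NNormT (d : ℕ) (V : EuclideanSpace ℝ (Fin d) → ℝ) (T : ℝ) : ℝ≥0∞ :=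
  ⨆ t ∈ Set.Ioc (0 : ℝ) T, NNorm d V t

/-- `r_*(V,t)`. -/
noncomputable def rStar (d : ℕ) (V : EuclideanSpace ℝ (Fin d) → ℝ) (t : ℝ) : ℝ≥0∞ :=
  ⨆ α, ⨆ x, ∫⁻ s in Set.Ioo (0 : ℝ) t, ∫⁻ z, ENNReal.ofReal (pk d α s x z * |V z|)

lemma pk_eq_const_mul {d : ℕ} {s : ℝ} (hs : 0 < s) (α x z : EuclideanSpace ℝ (Fin d)) :
    pk d α s x z = (4 * Real.pi) ^ (-(d : ℝ) / 2) *
      (s ^ (-(d : ℝ) / 2) * Real.exp (-‖z - x + (2 * s) • α‖ ^ 2 / (4 * s))) := by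
  unfold pk gauss
  rw [Real.mul_rpow (by positivity) hs.le, mul_assoc, sub_sub_eq_add_sub, add_sub_right_comm]

lemma const_mul_lintegral_eq_lintegral_pk {d : ℕ} (V : EuclideanSpace ℝ (Fin d) → ℝ) (T : ℝ)
    (α x : EuclideanSpace ℝ (Fin d)) :
    ENNReal.ofReal ((4 * Real.pi) ^ (-(d : ℝ) / 2)) *
      ∫⁻ s in Set.Ioo (0 : ℝ) T, ∫⁻ z, ENNReal.ofReal
        (s ^ (-(d : ℝ) / 2) * Real.exp (-‖z - x + (2 * s) • α‖ ^ 2 / (4 * s)) * |V z|) =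
    ∫⁻ s in Set.Ioo (0 : ℝ) T, ∫⁻ z, ENNReal.ofReal (pk d α s x z * |V z|) := by
  rw [← lintegral_const_mul' _ _ ENNReal.ofReal_ne_top]
  refine setLIntegral_congr_fun measurableSet_Ioo fun s hs => ?_
  rw [← lintegral_const_mul' _ _ ENNReal.ofReal_ne_top]
  refine lintegral_congr fun z => ?_
  rw [← ENNReal.ofReal_mul (by positivity), pk_eq_const_mul hs.1, ← mul_assoc]

lemma setLIntegral_Ioo_comp_sub_left (f : ℝ → ℝ≥0∞) (t a b : ℝ) :
    ∫⁻ s in Set.Ioo a b, f (t - s) = ∫⁻ τ in Set.Ioo (t - b) (t - a), f τ := by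
  have h := (volume.measurePreserving_sub_left t).setLIntegral_comp_preimage_emb
    (MeasurableEquiv.subLeft t).measurableEmbedding f (Set.Ioo (t - b) (t - a))
  rwa [Set.preimage_const_sub_Ioo, sub_sub_cancel, sub_sub_cancel] at h

/-- The two halves of `N` are integrals of the kernels with opposite drifts, started from `y` and
from `x` respectively. -/
lemma const_mul_Nk {d : ℕ} (V : EuclideanSpace ℝ (Fin d) → ℝ) {t : ℝ} (ht : 0 < t)
    (x y : EuclideanSpace ℝ (Fin d)) :
    ENNReal.ofReal ((4 * Real.pi) ^ (-(d : ℝ) / 2)) * Nk d V t x y =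
      (∫⁻ s in Set.Ioo (0 : ℝ) (t / 2), ∫⁻ z,
        ENNReal.ofReal (pk d ((2 * t)⁻¹ • (y - x)) s y z * |V z|)) +
      ∫⁻ s in Set.Ioo (0 : ℝ) (t / 2), ∫⁻ z,
        ENNReal.ofReal (pk d ((2 * t)⁻¹ • (x - y)) s x z * |V z|) := by
  have hdrift : ∀ s : ℝ, 2 * s * (2 * t)⁻¹ = s / t := fun s => by field_simp
  have hhalf : t - t / 2 = t / 2 := by ring
  have hreflect := setLIntegral_Ioo_comp_sub_left (fun τ => ∫⁻ z, ENNReal.ofReal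
      ((t - τ) ^ (-(d : ℝ) / 2) *
        Real.exp (-‖z - y + (τ / t) • (y - x)‖ ^ 2 / (4 * (t - τ))) * |V z|)) t 0 (t / 2)
  rw [hhalf, sub_zero] at hreflect
  have hcenter : ∀ (s : ℝ) (z : EuclideanSpace ℝ (Fin d)),
      z - y + ((t - s) / t) • (y - x) = z - x + (s / t) • (x - y) := fun s z => by
    rw [sub_div, div_self ht.ne']
    module
  rw [Nk, ← hreflect, mul_add, ← const_mul_lintegral_eq_lintegral_pk,
    ← const_mul_lintegral_eq_lintegral_pk]
  simp only [smul_smul, hdrift, sub_sub_cancel, hcenter]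

theorem stmt7 (d : ℕ) (hd : 1 ≤ d) (t : ℝ) (ht : 0 < t)
    (V : EuclideanSpace ℝ (Fin d) → ℝ) (hV : Measurable V) :
    rStar d V (t / 2) ≤ ENNReal.ofReal ((4 * Real.pi) ^ (-(d : ℝ) / 2)) * NNorm d V t ∧
    ENNReal.ofReal ((4 * Real.pi) ^ (-(d : ℝ) / 2)) * NNorm d V t ≤ 2 * rStar d V (t / 2) := by
  constructor
  · refine iSup₂_le fun α y => ?_
    have hα : (2 * t)⁻¹ • (y - (y - (2 * t) • α)) = α := by
      rw [sub_sub_cancel, inv_smul_smul₀ (by positivity)]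
    have h := const_mul_Nk V ht (y - (2 * t) • α) y
    rw [hα] at h
    exact (le_self_add.trans h.ge).trans
      (mul_le_mul_right (le_iSup₂ (f := fun x y => Nk d V t x y) _ _) _)
  · simp only [NNorm, ENNReal.mul_iSup]
    refine iSup₂_le fun x y => ?_
    rw [const_mul_Nk V ht, two_mul (rStar d V _)]
    exact add_le_add
      (le_iSup₂ (f := fun α x => ∫⁻ s in Set.Ioo (0 : ℝ) (t / 2), ∫⁻ z,
        ENNReal.ofReal (pk d α s x z * |V z|)) _ _)
      (le_iSup₂ (f := fun α x => ∫⁻ s in Set.Ioo (0 : ℝ) (t / 2), ∫⁻ z,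
        ENNReal.ofReal (pk d α s x z * |V z|)) _ _)
end

section
/- Let d ≥ 1. There exist constants m₁, m₂ > 0 depending only on d such that for every T > 0 and every Borel measurable V : ℝ^d → ℝ one has (m₁/2) ‖N(V)‖_{T,∞} ≤ ‖S(V)‖_{T,∞} ≤ m₂ ‖N(V)‖_{T,∞}. -/
open MeasureTheory Filter
open scoped ENNReal

theorem bridge_identity {E : Type*} [NormedAddCommGroup E] [InnerProductSpace ℝ E]
    {a b : ℝ} (ha : 0 < a) (hb : 0 < b) (w p : E) :
    ‖p‖ ^ 2 / b + ‖w - p‖ ^ 2 / a =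
      ‖w‖ ^ 2 / (a + b) + ‖p - (b / (a + b)) • w‖ ^ 2 / (b * a / (a + b)) := by
  have hab : 0 < a + b := by positivity
  rw [norm_sub_sq_real, norm_sub_sq_real, inner_smul_right, norm_smul, mul_pow,
    Real.norm_eq_abs, sq_abs, real_inner_comm w p]
  field_simp
  ring

/-- The Gaussian profile `τ ^ (-d / 2) * exp (-‖w‖ ^ 2 / (c * τ))`. -/
noncomputable def gaussProfile (d : ℕ) (c τ : ℝ) (w : EuclideanSpace ℝ (Fin d)) : ℝ :=
  τ ^ (-(d : ℝ) / 2) * Real.exp (-‖w‖ ^ 2 / (c * τ))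

theorem gaussProfile_nonneg (d : ℕ) {c τ : ℝ} (hτ : 0 < τ) (w : EuclideanSpace ℝ (Fin d)) :
    0 ≤ gaussProfile d c τ w := by
  unfold gaussProfile
  positivity

theorem measurable_gaussProfile (d : ℕ) (c : ℝ) :
    Measurable fun q : ℝ × EuclideanSpace ℝ (Fin d) ↦ gaussProfile d c q.1 q.2 := by
  unfold gaussProfile
  fun_prop

/-- The integral of `|V|` against Gaussians centred at `y + τ • v`, for `τ` in `I`. -/
noncomputable def driftIntegral (d : ℕ) (V : EuclideanSpace ℝ (Fin d) → ℝ) (c : ℝ)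
    (y v : EuclideanSpace ℝ (Fin d)) (I : Set ℝ) : ℝ≥0∞ :=
  ∫⁻ τ in I, ∫⁻ z, ENNReal.ofReal (gaussProfile d c τ (z - y - τ • v) * |V z|)

theorem gaussProfile_mul_gaussProfile (d : ℕ) {a b : ℝ} (ha : 0 < a) (hb : 0 < b) (c : ℝ)
    (w p : EuclideanSpace ℝ (Fin d)) :
    gaussProfile d c b p * gaussProfile d c a (w - p) =
      gaussProfile d c (a + b) w *
        gaussProfile d c (b * a / (a + b)) (p - (b / (a + b)) • w) := by
  have hab : 0 < a + b := by positivity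
  have hpow : b ^ (-(d : ℝ) / 2) * a ^ (-(d : ℝ) / 2) =
      (a + b) ^ (-(d : ℝ) / 2) * (b * a / (a + b)) ^ (-(d : ℝ) / 2) := by
    rw [← Real.mul_rpow hb.le ha.le, ← Real.mul_rpow hab.le (by positivity)]
    congr 1
    field_simp
  have hexp : Real.exp (-‖p‖ ^ 2 / (c * b)) * Real.exp (-‖w - p‖ ^ 2 / (c * a)) =
      Real.exp (-‖w‖ ^ 2 / (c * (a + b))) *
        Real.exp (-‖p - (b / (a + b)) • w‖ ^ 2 / (c * (b * a / (a + b)))) := by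
    rw [← Real.exp_add, ← Real.exp_add]
    have h := congrArg (fun r ↦ -c⁻¹ * r) (bridge_identity ha hb w p)
    congr 1
    calc _ = -c⁻¹ * (‖p‖ ^ 2 / b + ‖w - p‖ ^ 2 / a) := by
          rw [div_mul_eq_div_div, div_mul_eq_div_div]; ring
      _ = _ := h
      _ = _ := by
          rw [div_mul_eq_div_div _ c (a + b), div_mul_eq_div_div _ c (b * a / (a + b))]; ring
  unfold gaussProfile
  rw [mul_mul_mul_comm, hpow, hexp, mul_mul_mul_comm]

theorem gauss_eq_gaussProfile (d : ℕ) {t : ℝ} (ht : 0 < t) (x y : EuclideanSpace ℝ (Fin d)) :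
    gauss d t x y = (4 * Real.pi) ^ (-(d : ℝ) / 2) * gaussProfile d 4 t (y - x) := by
  unfold gauss gaussProfile
  rw [Real.mul_rpow (by positivity) ht.le, mul_assoc]

theorem gauss_bridge (d : ℕ) {s t : ℝ} (hs : 0 < s) (hst : s < t)
    (x y z : EuclideanSpace ℝ (Fin d)) :
    gauss d s x z * gauss d (t - s) z y / gauss d t x y =
      (4 * Real.pi) ^ (-(d : ℝ) / 2) *
        gaussProfile d 4 (s * (t - s) / t) (z - x - (s / t) • (y - x)) := by
  have ht : 0 < t := hs.trans hst
  have hts : 0 < t - s := sub_pos.2 hst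
  have h := gaussProfile_mul_gaussProfile d hts hs 4 (y - x) (z - x)
  rw [sub_add_cancel, sub_sub_sub_cancel_right] at h
  rw [gauss_eq_gaussProfile d hs, gauss_eq_gaussProfile d hts, gauss_eq_gaussProfile d ht]
  have hpos : 0 < gaussProfile d 4 t (y - x) := by unfold gaussProfile; positivity
  rw [div_eq_iff (by positivity), mul_mul_mul_comm, h]
  ring

theorem lintegral_gaussProfile_two (d : ℕ) {τ : ℝ} (hτ : 0 < τ)
    (w : EuclideanSpace ℝ (Fin d)) :
    ∫⁻ p, ENNReal.ofReal (gaussProfile d 2 τ (p - w)) =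
      ENNReal.ofReal ((2 * Real.pi) ^ ((d : ℝ) / 2)) := by
  rw [lintegral_sub_right_eq_self (fun p ↦ ENNReal.ofReal (gaussProfile d 2 τ p)) w]
  have hint : Integrable fun p : EuclideanSpace ℝ (Fin d) ↦ Real.exp (-(2 * τ)⁻¹ * ‖p‖ ^ 2) := by
    have := GaussianFourier.integrable_cexp_neg_mul_sq_norm_add
      (V := EuclideanSpace ℝ (Fin d)) (b := ((2 * τ)⁻¹ : ℝ)) (by
        rw [Complex.ofReal_re]; positivity) 0 0
    refine this.norm.congr (ae_of_all _ fun p ↦ ?_)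
    simp only [Complex.norm_exp]
    congr 1
    simp [← Complex.ofReal_pow]
  have heq : (fun p : EuclideanSpace ℝ (Fin d) ↦ gaussProfile d 2 τ p) =
      fun p ↦ τ ^ (-(d : ℝ) / 2) * Real.exp (-(2 * τ)⁻¹ * ‖p‖ ^ 2) := by
    funext p
    unfold gaussProfile
    congr 2
    ring
  rw [← ofReal_integral_eq_lintegral_ofReal (heq ▸ hint.const_mul _)
    (ae_of_all _ fun p ↦ gaussProfile_nonneg d hτ p), heq, integral_const_mul,
    GaussianFourier.integral_rexp_neg_mul_sq_norm (by positivity), finrank_euclideanSpace_fin]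
  congr 1
  rw [div_inv_eq_mul, show Real.pi * (2 * τ) = τ * (2 * Real.pi) by ring,
    Real.mul_rpow hτ.le (by positivity), ← mul_assoc, ← Real.rpow_add hτ]
  simp [neg_div]

theorem lintegral_gaussProfile_convolution (d : ℕ) {a b : ℝ} (ha : 0 < a) (hb : 0 < b)
    (w : EuclideanSpace ℝ (Fin d)) :
    ∫⁻ p, ENNReal.ofReal (gaussProfile d 2 b p * gaussProfile d 2 a (w - p)) =
      ENNReal.ofReal ((2 * Real.pi) ^ ((d : ℝ) / 2)) *
        ENNReal.ofReal (gaussProfile d 2 (a + b) w) := by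
  have hab : 0 < a + b := by positivity
  simp_rw [gaussProfile_mul_gaussProfile d ha hb 2 w,
    ENNReal.ofReal_mul (gaussProfile_nonneg d hab w)]
  rw [lintegral_const_mul' _ _ ENNReal.ofReal_ne_top,
    lintegral_gaussProfile_two d (by positivity), mul_comm]

theorem measurable_driftIntegrand (d : ℕ) {V : EuclideanSpace ℝ (Fin d) → ℝ} (hV : Measurable V)
    (c : ℝ) (v : EuclideanSpace ℝ (Fin d)) :
    Measurable fun q : EuclideanSpace ℝ (Fin d) × ℝ × EuclideanSpace ℝ (Fin d) ↦
      ENNReal.ofReal (gaussProfile d c q.2.1 (q.2.2 - q.1 - q.2.1 • v) * |V q.2.2|) := by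
  have := (measurable_gaussProfile d c).comp
    (f := fun q : EuclideanSpace ℝ (Fin d) × ℝ × EuclideanSpace ℝ (Fin d) ↦
      (q.2.1, q.2.2 - q.1 - q.2.1 • v)) (by fun_prop)
  simp only [Function.comp_def] at this
  have hV' : Measurable fun q : EuclideanSpace ℝ (Fin d) × ℝ × EuclideanSpace ℝ (Fin d) ↦
    |V q.2.2| := by fun_prop
  exact (this.mul hV').ennreal_ofReal

theorem lintegral_rotate {α β γ : Type*} [MeasurableSpace α] [MeasurableSpace β]
    [MeasurableSpace γ] {μ : Measure α} {ν : Measure β} {ρ : Measure γ} [SFinite μ] [SFinite ν]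
    [SFinite ρ] {F : α → β → γ → ℝ≥0∞}
    (hF : Measurable fun q : α × β × γ ↦ F q.1 q.2.1 q.2.2) :
    ∫⁻ p, ∫⁻ r, ∫⁻ z, F p r z ∂ρ ∂ν ∂μ = ∫⁻ r, ∫⁻ z, ∫⁻ p, F p r z ∂μ ∂ρ ∂ν := by
  have hF' : Measurable fun q : (α × β) × γ ↦ F q.1.1 q.1.2 q.2 :=
    hF.comp MeasurableEquiv.prodAssoc.measurable
  rw [lintegral_lintegral_swap hF'.lintegral_prod_right'.aemeasurable]
  refine lintegral_congr fun r ↦ lintegral_lintegral_swap ?_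
  exact (hF.comp (measurable_fst.prodMk
    (measurable_const.prodMk measurable_snd)) : Measurable fun q : α × γ ↦ F q.1 r q.2).aemeasurable

theorem driftIntegral_shift_le (d : ℕ) {V : EuclideanSpace ℝ (Fin d) → ℝ} (hV : Measurable V)
    (y v : EuclideanSpace ℝ (Fin d)) {h : ℝ} (hh : 0 < h) :
    driftIntegral d V 2 y v (Set.Ioo h (2 * h)) ≤
      ⨆ y', driftIntegral d V 2 y' v (Set.Ioo 0 h) := by
  set K := ENNReal.ofReal ((2 * Real.pi) ^ ((d : ℝ) / 2)) with hK
  have hK0 : K ≠ 0 := by rw [hK, ne_eq, ENNReal.ofReal_eq_zero, not_le]; positivity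
  have hKtop : K ≠ ∞ := ENNReal.ofReal_ne_top
  have hprof : Measurable fun p : EuclideanSpace ℝ (Fin d) ↦
      ENNReal.ofReal (gaussProfile d 2 h p) :=
    ((measurable_gaussProfile d 2).comp (measurable_const.prodMk measurable_id)).ennreal_ofReal
  have hshift : driftIntegral d V 2 y v (Set.Ioo h (2 * h)) =
      ∫⁻ r in Set.Ioo 0 h, ∫⁻ z, ENNReal.ofReal
        (gaussProfile d 2 (r + h) (z - (y + h • v) - r • v) * |V z|) := by
    have himage : (fun r : ℝ ↦ r + h) '' Set.Ioo 0 h = Set.Ioo h (2 * h) := by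
      rw [Set.image_add_const_Ioo, zero_add, two_mul]
    rw [driftIntegral, ← himage, lintegral_image_eq_lintegral_abs_deriv_mul measurableSet_Ioo
      (f' := fun _ ↦ 1) (fun r _ ↦ ((hasDerivAt_id' r).add_const h).hasDerivWithinAt)
      (add_left_injective h).injOn]
    simp only [abs_one, ENNReal.ofReal_one, one_mul, add_smul]
    refine lintegral_congr fun r ↦ lintegral_congr fun z ↦ ?_
    congr 3
    abel
  have hconv : K * driftIntegral d V 2 y v (Set.Ioo h (2 * h)) =
      ∫⁻ p, ENNReal.ofReal (gaussProfile d 2 h p) *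
        driftIntegral d V 2 (y + h • v + p) v (Set.Ioo 0 h) := by
    have hmeas := (measurable_driftIntegrand d hV 2 v).comp
      (f := fun q : EuclideanSpace ℝ (Fin d) × ℝ × EuclideanSpace ℝ (Fin d) ↦
        (y + h • v + q.1, q.2)) (by fun_prop)
    simp only [Function.comp_def] at hmeas
    have hF : Measurable fun q : EuclideanSpace ℝ (Fin d) × ℝ × EuclideanSpace ℝ (Fin d) ↦
        ENNReal.ofReal (gaussProfile d 2 h q.1) * ENNReal.ofReal
          (gaussProfile d 2 q.2.1 (q.2.2 - (y + h • v + q.1) - q.2.1 • v) * |V q.2.2|) :=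
      (hprof.comp measurable_fst).mul hmeas
    rw [hshift, ← lintegral_const_mul' _ _ hKtop]
    have hpull : ∀ p, ENNReal.ofReal (gaussProfile d 2 h p) *
        driftIntegral d V 2 (y + h • v + p) v (Set.Ioo 0 h) =
        ∫⁻ r in Set.Ioo 0 h, ∫⁻ z, ENNReal.ofReal (gaussProfile d 2 h p) * ENNReal.ofReal
          (gaussProfile d 2 r (z - (y + h • v + p) - r • v) * |V z|) := fun p ↦ by
      rw [driftIntegral, ← lintegral_const_mul' _ _ ENNReal.ofReal_ne_top]
      refine lintegral_congr fun r ↦ ?_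
      rw [lintegral_const_mul' _ _ ENNReal.ofReal_ne_top]
    simp_rw [hpull]
    rw [lintegral_rotate (F := fun p r z ↦ ENNReal.ofReal (gaussProfile d 2 h p) * ENNReal.ofReal
      (gaussProfile d 2 r (z - (y + h • v + p) - r • v) * |V z|)) hF]
    refine setLIntegral_congr_fun measurableSet_Ioo fun r hr ↦ ?_
    rw [← lintegral_const_mul' _ _ hKtop]
    refine lintegral_congr fun z ↦ ?_
    rw [ENNReal.ofReal_mul (gaussProfile_nonneg d (add_pos hr.1 hh) _), ← mul_assoc,
      ← lintegral_gaussProfile_convolution d hr.1 hh,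
      ← lintegral_mul_const' _ _ ENNReal.ofReal_ne_top]
    refine lintegral_congr fun p ↦ ?_
    rw [ENNReal.ofReal_mul (gaussProfile_nonneg d hh _),
      ENNReal.ofReal_mul (gaussProfile_nonneg d hr.1 _), mul_assoc]
    congr 4
    abel
  rw [← ENNReal.mul_le_mul_iff_right hK0 hKtop, hconv]
  calc _ ≤ ∫⁻ p, ENNReal.ofReal (gaussProfile d 2 h p) *
        ⨆ y', driftIntegral d V 2 y' v (Set.Ioo 0 h) :=
        lintegral_mono fun p ↦ mul_le_mul_right (le_iSup
          (fun y' ↦ driftIntegral d V 2 y' v (Set.Ioo 0 h)) _) _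
    _ = _ := by
        rw [lintegral_mul_const _ hprof]
        have := lintegral_gaussProfile_two d hh 0
        simp only [sub_zero] at this
        rw [this]

theorem setLIntegral_Ioo_le_add (f : ℝ → ℝ≥0∞) (a b c : ℝ) :
    ∫⁻ s in Set.Ioo a c, f s ≤ (∫⁻ s in Set.Ioo a b, f s) + ∫⁻ s in Set.Ioo b c, f s := by
  calc ∫⁻ s in Set.Ioo a c, f s ≤ ∫⁻ s in Set.Ioo a b ∪ Set.Icc b c, f s :=
        lintegral_mono_set fun s hs ↦ (lt_or_ge s b).imp (fun h ↦ ⟨hs.1, h⟩) (fun h ↦ ⟨h, hs.2.le⟩)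
    _ ≤ _ := lintegral_union_le _ _ _
    _ = _ := by rw [setLIntegral_congr (Ioo_ae_eq_Icc (a := b) (b := c))]

theorem driftIntegral_le_SNorm (d : ℕ) (V : EuclideanSpace ℝ (Fin d) → ℝ) {t : ℝ} (ht : 0 < t)
    (y v : EuclideanSpace ℝ (Fin d)) :
    driftIntegral d V 2 y v (Set.Ioo 0 (t / 2)) ≤
      ENNReal.ofReal ((4 * Real.pi) ^ ((d : ℝ) / 2)) * SNorm d V t := by
  calc _ ≤ ENNReal.ofReal ((4 * Real.pi) ^ ((d : ℝ) / 2)) * Sk d V t y (y + t • v) := ?_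
    _ ≤ _ := mul_le_mul_right (le_iSup_of_le y (le_iSup (Sk d V t y) _)) _
  rw [driftIntegral, Sk, ← lintegral_const_mul' _ _ ENNReal.ofReal_ne_top]
  refine (setLIntegral_mono' measurableSet_Ioo fun s hs ↦ ?_).trans
    (lintegral_mono_set (Set.Ioo_subset_Ioo_right (by linarith)))
  obtain ⟨hs0, hs1⟩ := hs
  rw [← lintegral_const_mul' _ _ ENNReal.ofReal_ne_top]
  refine lintegral_mono fun z ↦ ?_
  rw [← ENNReal.ofReal_mul (by positivity), ← mul_assoc]
  refine ENNReal.ofReal_le_ofReal (mul_le_mul_of_nonneg_right ?_ (abs_nonneg _))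
  have hσ0 : 0 < s * (t - s) / t := div_pos (mul_pos hs0 (by linarith)) ht
  have hσ1 : s * (t - s) / t ≤ s := by
    rw [div_le_iff₀ ht]; nlinarith
  have hσ2 : s ≤ 2 * (s * (t - s) / t) := by
    rw [← mul_div_assoc, le_div_iff₀ ht]; nlinarith
  rw [gauss_bridge d hs0 (by linarith), ← mul_assoc, ← Real.rpow_add (by positivity),
    neg_div, add_neg_cancel, Real.rpow_zero, one_mul, add_sub_cancel_left, smul_smul,
    div_mul_cancel₀ _ ht.ne']
  unfold gaussProfile
  refine mul_le_mul ?_ ?_ (Real.exp_pos _).le (by positivity)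
  · exact Real.rpow_le_rpow_of_nonpos hσ0 hσ1 (by rw [neg_div]; exact neg_nonpos.2 (by positivity))
  · rw [Real.exp_le_exp, neg_div, neg_div, neg_le_neg_iff]
    exact div_le_div_of_nonneg_left (by positivity) (by positivity) (by linarith)

theorem driftIntegral_four_le (d : ℕ) {V : EuclideanSpace ℝ (Fin d) → ℝ} (hV : Measurable V)
    {t : ℝ} (ht : 0 < t) (y v : EuclideanSpace ℝ (Fin d)) :
    driftIntegral d V 4 y v (Set.Ioo 0 (t / 2)) ≤
      ENNReal.ofReal ((8 * Real.pi) ^ ((d : ℝ) / 2)) * SNorm d V t := by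
  have himage : (fun u : ℝ ↦ 2⁻¹ * u) '' Set.Ioo 0 t = Set.Ioo 0 (t / 2) := by
    rw [Set.image_mul_left_Ioo (by norm_num)]
    ring_nf
  have hscale : driftIntegral d V 4 y v (Set.Ioo 0 (t / 2)) =
      ENNReal.ofReal (2⁻¹ * 2 ^ ((d : ℝ) / 2)) *
        driftIntegral d V 2 y ((2⁻¹ : ℝ) • v) (Set.Ioo 0 t) := by
    rw [driftIntegral, ← himage, lintegral_image_eq_lintegral_abs_deriv_mul measurableSet_Ioo
      (f' := fun _ ↦ 2⁻¹) (fun u _ ↦ by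
        simpa using ((hasDerivAt_id u).const_mul (2⁻¹ : ℝ)).hasDerivWithinAt)
      (mul_right_injective₀ (by norm_num : (2⁻¹ : ℝ) ≠ 0)).injOn, driftIntegral,
      ← lintegral_const_mul' _ _ ENNReal.ofReal_ne_top]
    refine setLIntegral_congr_fun measurableSet_Ioo fun u hu ↦ ?_
    rw [← lintegral_const_mul' _ _ ENNReal.ofReal_ne_top,
      ← lintegral_const_mul' _ _ ENNReal.ofReal_ne_top]
    refine lintegral_congr fun z ↦ ?_
    rw [← ENNReal.ofReal_mul (by positivity), ← ENNReal.ofReal_mul (by positivity),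
      smul_smul, mul_comm u 2⁻¹, abs_of_pos (by norm_num : (0 : ℝ) < 2⁻¹)]
    congr 1
    unfold gaussProfile
    rw [Real.mul_rpow (by norm_num) hu.1.le, Real.inv_rpow (by norm_num), neg_div,
      Real.rpow_neg (by norm_num), inv_inv, ← mul_assoc (4 : ℝ)]
    norm_num
    ring
  have hsup : ⨆ y', driftIntegral d V 2 y' ((2⁻¹ : ℝ) • v) (Set.Ioo 0 (t / 2)) ≤
      ENNReal.ofReal ((4 * Real.pi) ^ ((d : ℝ) / 2)) * SNorm d V t :=
    iSup_le fun y' ↦ driftIntegral_le_SNorm d V ht y' _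
  have hshift := driftIntegral_shift_le d hV y ((2⁻¹ : ℝ) • v) (half_pos ht)
  rw [mul_div_cancel₀ t two_ne_zero] at hshift
  rw [hscale]
  calc _ ≤ ENNReal.ofReal (2⁻¹ * 2 ^ ((d : ℝ) / 2)) *
        (2 * (ENNReal.ofReal ((4 * Real.pi) ^ ((d : ℝ) / 2)) * SNorm d V t)) := by
        refine mul_le_mul_right ((setLIntegral_Ioo_le_add _ 0 (t / 2) t).trans ?_) _
        rw [two_mul]
        exact add_le_add (driftIntegral_le_SNorm d V ht _ _) (hshift.trans hsup)
    _ = _ := by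
        rw [← mul_assoc, ← mul_assoc, ← ENNReal.ofReal_ofNat 2,
          ← ENNReal.ofReal_mul (by positivity), ← ENNReal.ofReal_mul (by positivity)]
        congr 2
        rw [show (8 : ℝ) * Real.pi = 2 * (4 * Real.pi) by ring,
          Real.mul_rpow (x := 2) (y := 4 * Real.pi) (by norm_num) (by positivity)]
        ring

theorem Nk_eq_add_driftIntegral (d : ℕ) (V : EuclideanSpace ℝ (Fin d) → ℝ) {t : ℝ} (ht : 0 < t)
    (x y : EuclideanSpace ℝ (Fin d)) :
    Nk d V t x y = driftIntegral d V 4 y (t⁻¹ • (x - y)) (Set.Ioo 0 (t / 2)) +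
      driftIntegral d V 4 x (t⁻¹ • (y - x)) (Set.Ioo 0 (t / 2)) := by
  unfold Nk driftIntegral
  congr 1
  · refine lintegral_congr fun τ ↦ lintegral_congr fun z ↦ ?_
    have : z - y + (τ / t) • (y - x) = z - y - τ • t⁻¹ • (x - y) := by
      rw [smul_smul, ← div_eq_mul_inv]; module
    rw [this, gaussProfile]
  · have himage : (fun u : ℝ ↦ t - u) '' Set.Ioo 0 (t / 2) = Set.Ioo (t / 2) t := by
      rw [Set.image_const_sub_Ioo]
      ring_nf
    rw [← himage, lintegral_image_eq_lintegral_abs_deriv_mul measurableSet_Ioo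
      (f' := fun _ ↦ -1) (fun u _ ↦ ((hasDerivAt_id' u).const_sub t).hasDerivWithinAt)
      (sub_right_injective).injOn]
    refine lintegral_congr fun u ↦ ?_
    rw [abs_neg, abs_one, ENNReal.ofReal_one, one_mul]
    refine lintegral_congr fun z ↦ ?_
    have : z - y + ((t - u) / t) • (y - x) = z - x - u • t⁻¹ • (y - x) := by
      rw [smul_smul, sub_div, div_self ht.ne', ← div_eq_mul_inv]; module
    rw [this, gaussProfile, sub_sub_cancel]

theorem Nk_le_SNorm (d : ℕ) {V : EuclideanSpace ℝ (Fin d) → ℝ} (hV : Measurable V)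
    {t : ℝ} (ht : 0 < t) (x y : EuclideanSpace ℝ (Fin d)) :
    Nk d V t x y ≤ ENNReal.ofReal (2 * (8 * Real.pi) ^ ((d : ℝ) / 2)) * SNorm d V t := by
  rw [Nk_eq_add_driftIntegral d V ht, two_mul, ENNReal.ofReal_add (by positivity) (by positivity),
    add_mul]
  exact add_le_add (driftIntegral_four_le d hV ht _ _) (driftIntegral_four_le d hV ht _ _)

theorem gaussProfile_bridge_le (d : ℕ) {σ τ : ℝ} (hτ : 0 < τ) (h₁ : σ ≤ τ) (h₂ : τ ≤ 2 * σ)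
    (w : EuclideanSpace ℝ (Fin d)) :
    (4 * Real.pi) ^ (-(d : ℝ) / 2) * gaussProfile d 4 σ w ≤
      (2 * Real.pi) ^ (-(d : ℝ) / 2) * gaussProfile d 4 τ w := by
  have hσ : 0 < σ := by linarith
  unfold gaussProfile
  rw [← mul_assoc, ← mul_assoc, ← Real.mul_rpow (by positivity) hσ.le,
    ← Real.mul_rpow (by positivity) hτ.le]
  refine mul_le_mul ?_ ?_ (Real.exp_pos _).le (by positivity)
  · refine Real.rpow_le_rpow_of_nonpos (by positivity) ?_
      (by rw [neg_div]; exact neg_nonpos.2 (by positivity))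
    nlinarith [Real.pi_pos]
  · rw [Real.exp_le_exp, neg_div, neg_div, neg_le_neg_iff]
    exact div_le_div_of_nonneg_left (by positivity) (by positivity) (by linarith)

theorem Sk_le_Nk (d : ℕ) (V : EuclideanSpace ℝ (Fin d) → ℝ) {t : ℝ} (ht : 0 < t)
    (x y : EuclideanSpace ℝ (Fin d)) :
    Sk d V t y x ≤ ENNReal.ofReal ((2 * Real.pi) ^ (-(d : ℝ) / 2)) * Nk d V t x y := by
  have hpoint : ∀ {s τ : ℝ}, 0 < s → s < t → 0 < τ → s * (t - s) / t ≤ τ →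
      τ ≤ 2 * (s * (t - s) / t) →
      ∫⁻ z, ENNReal.ofReal (gauss d s y z * gauss d (t - s) z x / gauss d t y x * |V z|) ≤
        ENNReal.ofReal ((2 * Real.pi) ^ (-(d : ℝ) / 2)) * ∫⁻ z, ENNReal.ofReal
          (τ ^ (-(d : ℝ) / 2) * Real.exp (-‖z - y + (s / t) • (y - x)‖ ^ 2 / (4 * τ)) * |V z|) := by
    intro s τ hs hst hτ h₁ h₂
    rw [← lintegral_const_mul' _ _ ENNReal.ofReal_ne_top]
    refine lintegral_mono fun z ↦ ?_
    rw [← ENNReal.ofReal_mul (by positivity), ← mul_assoc, gauss_bridge d hs hst]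
    refine ENNReal.ofReal_le_ofReal (mul_le_mul_of_nonneg_right ?_ (abs_nonneg _))
    have : z - y - (s / t) • (x - y) = z - y + (s / t) • (y - x) := by module
    rw [this]
    exact gaussProfile_bridge_le d hτ h₁ h₂ _
  unfold Nk
  rw [mul_add]
  refine (setLIntegral_Ioo_le_add _ 0 (t / 2) t).trans (add_le_add ?_ ?_)
  · rw [← lintegral_const_mul' _ _ ENNReal.ofReal_ne_top]
    refine setLIntegral_mono' measurableSet_Ioo fun s ⟨hs, hst⟩ ↦
      hpoint hs (by linarith) hs ?_ ?_
    · rw [div_le_iff₀ ht]; nlinarith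
    · rw [← mul_div_assoc, le_div_iff₀ ht]; nlinarith
  · rw [← lintegral_const_mul' _ _ ENNReal.ofReal_ne_top]
    refine setLIntegral_mono' measurableSet_Ioo fun s ⟨hs, hst⟩ ↦
      hpoint (by linarith) hst (by linarith) ?_ ?_
    · rw [div_le_iff₀ ht]; nlinarith
    · rw [← mul_div_assoc, le_div_iff₀ ht]; nlinarith

theorem stmt9 (d : ℕ) (hd : 1 ≤ d) :
    ∃ m₁ m₂ : ℝ, 0 < m₁ ∧ 0 < m₂ ∧
    ∀ T : ℝ, 0 < T → ∀ V : EuclideanSpace ℝ (Fin d) → ℝ, Measurable V →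
      ENNReal.ofReal (m₁ / 2) * NNormT d V T ≤ SNormT d V T ∧
      SNormT d V T ≤ ENNReal.ofReal m₂ * NNormT d V T := by
  refine ⟨((8 * Real.pi) ^ ((d : ℝ) / 2))⁻¹, (2 * Real.pi) ^ (-(d : ℝ) / 2), by positivity,
    by positivity, fun T _ V hV ↦ ⟨?_, ?_⟩⟩
  · have hN : NNormT d V T ≤
        ENNReal.ofReal (2 * (8 * Real.pi) ^ ((d : ℝ) / 2)) * SNormT d V T :=
      iSup₂_le fun t ht ↦ iSup₂_le fun x y ↦ (Nk_le_SNorm d hV ht.1 x y).trans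
        (mul_le_mul_right (le_iSup₂ (f := fun t (_ : t ∈ Set.Ioc 0 T) ↦ SNorm d V t) t ht) _)
    refine (mul_le_mul_right hN _).trans_eq ?_
    have hone : ((8 * Real.pi) ^ ((d : ℝ) / 2))⁻¹ / 2 * (2 * (8 * Real.pi) ^ ((d : ℝ) / 2)) = 1 := by
      have : (8 * Real.pi) ^ ((d : ℝ) / 2) ≠ 0 := by positivity
      field_simp
    rw [← mul_assoc, ← ENNReal.ofReal_mul (by positivity), hone, ENNReal.ofReal_one, one_mul]
  · exact iSup₂_le fun t ht ↦ iSup₂_le fun y x ↦ (Sk_le_Nk d V ht.1 x y).trans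
      (mul_le_mul_right
        ((le_iSup_of_le x (le_iSup (Nk d V t x) y)).trans
          (le_iSup₂ (f := fun t (_ : t ∈ Set.Ioc 0 T) ↦ NNorm d V t) t ht)) _)
end

section
/- Let d ≥ 1. For every T > 0 and every Borel measurable V : ℝ^d → ℝ one has ‖N(V,T)‖_∞ ≤ ‖N(V)‖_{T,∞} ≤ 2 ‖N(V,T)‖_∞; moreover there exists a constant C > 0 depending only on d such that ‖S(V,T)‖_∞ ≤ ‖S(V)‖_{T,∞} ≤ C ‖S(V,T)‖_∞ for every T > 0 and every Borel measurable V. -/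
open MeasureTheory Filter
open scoped ENNReal

lemma setLIntegral_Ioo_comp_const_sub (f : ℝ → ℝ≥0∞) (a b c : ℝ) :
    ∫⁻ s in Set.Ioo a b, f (c - s) = ∫⁻ s in Set.Ioo (c - b) (c - a), f s := by
  have h := lintegral_image_eq_lintegral_abs_deriv_mul (s := Set.Ioo a b) (f := fun s => c - s)
    (f' := fun _ => -1) measurableSet_Ioo
    (fun s _ => ((hasDerivAt_id s).const_sub c).hasDerivWithinAt)
    (fun _ _ _ _ h => sub_right_injective h) f
  simpa using h.symm

lemma setLIntegral_Ioo_comp_const_add (f : ℝ → ℝ≥0∞) (a b c : ℝ) :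
    ∫⁻ s in Set.Ioo a b, f (c + s) = ∫⁻ s in Set.Ioo (c + a) (c + b), f s := by
  have h := lintegral_image_eq_lintegral_abs_deriv_mul (s := Set.Ioo a b) (f := fun s => c + s)
    (f' := fun _ => 1) measurableSet_Ioo
    (fun s _ => ((hasDerivAt_id s).const_add c).hasDerivWithinAt)
    (fun _ _ _ _ h => add_right_injective c h) f
  rw [Set.image_const_add_Ioo] at h
  simpa using h.symm

lemma setLIntegral_Ioo_comp_two_mul (f : ℝ → ℝ≥0∞) (a b : ℝ) :
    ∫⁻ s in Set.Ioo (2 * a) (2 * b), f s = 2 * ∫⁻ s in Set.Ioo a b, f (2 * s) := by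
  have h := lintegral_image_eq_lintegral_abs_deriv_mul (s := Set.Ioo a b) (f := fun s => 2 * s)
    (f' := fun _ => 2) measurableSet_Ioo
    (fun s _ => by simpa using ((hasDerivAt_id s).const_mul (2 : ℝ)).hasDerivWithinAt)
    (fun _ _ _ _ h => by simpa using h) f
  rw [Set.image_mul_left_Ioo (by norm_num)] at h
  rw [h, ← lintegral_const_mul' _ _ (by simp)]
  simp

lemma setLIntegral_Ioo_split (f : ℝ → ℝ≥0∞) {a b c : ℝ} (hab : a < b) (hbc : b < c) :
    ∫⁻ s in Set.Ioo a c, f s = (∫⁻ s in Set.Ioo a b, f s) + ∫⁻ s in Set.Ioo b c, f s := by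
  rw [← Set.Ioc_union_Ioo_eq_Ioo hab.le hbc, lintegral_union measurableSet_Ioo,
    setLIntegral_congr Ioo_ae_eq_Ioc.symm]
  rw [Set.disjoint_left]
  intro s hs hs'
  exact absurd hs'.1 (not_lt.mpr hs.2)

section Gauss

variable {d : ℕ}

lemma gauss_pos {t : ℝ} (ht : 0 < t) (x y : EuclideanSpace ℝ (Fin d)) : 0 < gauss d t x y := by
  unfold gauss; positivity

lemma gauss_nonneg {t : ℝ} (ht : 0 < t) (x y : EuclideanSpace ℝ (Fin d)) : 0 ≤ gauss d t x y :=
  (gauss_pos ht x y).le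

lemma gauss_symm (t : ℝ) (x y : EuclideanSpace ℝ (Fin d)) : gauss d t x y = gauss d t y x := by
  rw [gauss, gauss, norm_sub_rev]

lemma gauss_add_add (t : ℝ) (x y w : EuclideanSpace ℝ (Fin d)) :
    gauss d t (x + w) (y + w) = gauss d t x y := by
  rw [gauss, gauss, add_sub_add_right_eq_sub]

lemma measurable_gauss :
    Measurable fun p : ℝ × EuclideanSpace ℝ (Fin d) × EuclideanSpace ℝ (Fin d) =>
      gauss d p.1 p.2.1 p.2.2 := by
  unfold gauss; fun_prop

lemma lintegral_gauss {t : ℝ} (ht : 0 < t) (x : EuclideanSpace ℝ (Fin d)) :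
    ∫⁻ z, ENNReal.ofReal (gauss d t x z) = 1 := by
  have hb : 0 < 1 / (4 * t) := by positivity
  have hint := GaussianFourier.integral_rexp_neg_mul_sq_norm (V := EuclideanSpace ℝ (Fin d)) hb
  have hpos : 0 < (Real.pi / (1 / (4 * t))) ^
      (Module.finrank ℝ (EuclideanSpace ℝ (Fin d)) / 2 : ℝ) := by positivity
  have hI : Integrable fun v : EuclideanSpace ℝ (Fin d) => Real.exp (-(1 / (4 * t)) * ‖v‖ ^ 2) :=
    Integrable.of_integral_ne_zero (by rw [hint]; exact hpos.ne')
  have h0 : ∀ z, gauss d t x z = (fun v => (4 * Real.pi * t) ^ (-(d : ℝ) / 2) *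
      Real.exp (-(1 / (4 * t)) * ‖v‖ ^ 2)) (z - x) := by
    intro z
    simp only [gauss]
    congr 2
    ring
  simp_rw [h0]
  rw [lintegral_sub_right_eq_self (fun v : EuclideanSpace ℝ (Fin d) =>
    ENNReal.ofReal ((4 * Real.pi * t) ^ (-(d : ℝ) / 2) * Real.exp (-(1 / (4 * t)) * ‖v‖ ^ 2))),
    ← ofReal_integral_eq_lintegral_ofReal (hI.const_mul _) (ae_of_all _ fun v => by positivity),
    integral_const_mul, hint, finrank_euclideanSpace_fin,
    show Real.pi / (1 / (4 * t)) = 4 * Real.pi * t by field_simp,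
    ← Real.rpow_add (by positivity)]
  simp [neg_div]

/-- The product of two heat kernels is a heat kernel times the density of a Brownian bridge. -/
lemma gauss_mul_gauss {s r : ℝ} (hs : 0 < s) (hr : 0 < r) (x y z : EuclideanSpace ℝ (Fin d)) :
    gauss d s x z * gauss d r z y =
      gauss d (s + r) x y * gauss d (s * r / (s + r)) (x + (s / (s + r)) • (y - x)) z := by
  have hsr : 0 < s + r := by positivity
  unfold gauss
  rw [mul_mul_mul_comm, mul_mul_mul_comm ((4 * Real.pi * (s + r)) ^ _),
    ← Real.mul_rpow (by positivity) (by positivity),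
    ← Real.mul_rpow (by positivity) (by positivity), ← Real.exp_add, ← Real.exp_add]
  congr 2
  · field_simp
  · have h1 : y - z = (y - x) - (z - x) := by abel
    have h2 : z - (x + (s / (s + r)) • (y - x)) = (z - x) - (s / (s + r)) • (y - x) := by abel
    rw [h1, h2]
    generalize y - x = q
    generalize z - x = p
    rw [norm_sub_sq_real, norm_sub_sq_real, inner_smul_right, norm_smul, mul_pow,
      real_inner_comm p q, Real.norm_eq_abs, sq_abs]
    field_simp
    ring

/-- The Chapman-Kolmogorov equation. -/
lemma lintegral_gauss_mul_gauss {s r : ℝ} (hs : 0 < s) (hr : 0 < r)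
    (x y : EuclideanSpace ℝ (Fin d)) :
    ∫⁻ u, ENNReal.ofReal (gauss d s x u) * ENNReal.ofReal (gauss d r u y) =
      ENNReal.ofReal (gauss d (s + r) x y) := by
  simp_rw [← ENNReal.ofReal_mul (gauss_nonneg hs _ _), gauss_mul_gauss hs hr,
    ENNReal.ofReal_mul (gauss_nonneg (add_pos hs hr) _ _)]
  rw [lintegral_const_mul' _ _ ENNReal.ofReal_ne_top, lintegral_gauss (by positivity), mul_one]

lemma gauss_le_of_le {a b : ℝ} (ha : 0 < a) (hab : a ≤ b) (hba : b ≤ 2 * a)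
    (x y : EuclideanSpace ℝ (Fin d)) :
    gauss d a x y ≤ 2 ^ ((d : ℝ) / 2) * gauss d b x y := by
  have hb : 0 < b := ha.trans_le hab
  unfold gauss
  rw [← mul_assoc]
  refine mul_le_mul ?_ ?_ (by positivity) (by positivity)
  · have h2 : (2 : ℝ) ^ ((d : ℝ) / 2) = (1 / 2) ^ (-(d : ℝ) / 2) := by
      rw [one_div, Real.inv_rpow (by norm_num), neg_div, Real.rpow_neg (by norm_num), inv_inv]
    rw [h2, ← Real.mul_rpow (by positivity) (by positivity)]
    refine Real.rpow_le_rpow_of_nonpos (by positivity) ?_ (by rw [neg_div]; simp; positivity)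
    nlinarith [Real.pi_pos]
  · exact Real.exp_le_exp.mpr (by rw [neg_div, neg_div, neg_le_neg_iff]; gcongr)

end Gauss

/-- The time integral up to `r` of `|V|` against the heat kernel with drift `w`. -/
noncomputable def driftPotential (d : ℕ) (V : EuclideanSpace ℝ (Fin d) → ℝ) (r : ℝ)
    (x w : EuclideanSpace ℝ (Fin d)) : ℝ≥0∞ :=
  ∫⁻ s in Set.Ioo (0 : ℝ) r, ∫⁻ z, ENNReal.ofReal (gauss d s (x + s • w) z * |V z|)

section Drift

variable {d : ℕ} {V : EuclideanSpace ℝ (Fin d) → ℝ}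

lemma setLIntegral_Ioo_drift_shift (hV : Measurable V) {r : ℝ} (hr : 0 < r)
    (x w : EuclideanSpace ℝ (Fin d)) :
    ∫⁻ s in Set.Ioo r (2 * r), ∫⁻ z, ENNReal.ofReal (gauss d s (x + s • w) z * |V z|) =
      ∫⁻ u, ENNReal.ofReal (gauss d r (x + r • w) u) * driftPotential d V r u w := by
  have hg := measurable_gauss (d := d)
  have key : ∀ s ∈ Set.Ioo 0 r,
      ∫⁻ z, ENNReal.ofReal (gauss d (r + s) (x + (r + s) • w) z * |V z|) =
        ∫⁻ u, ENNReal.ofReal (gauss d r (x + r • w) u) *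
          ∫⁻ z, ENNReal.ofReal (gauss d s (u + s • w) z * |V z|) := by
    intro s hs
    have h1 : ∀ z, ENNReal.ofReal (gauss d (r + s) (x + (r + s) • w) z * |V z|) =
        ∫⁻ u, ENNReal.ofReal (gauss d r (x + r • w) u) *
          ENNReal.ofReal (gauss d s (u + s • w) z * |V z|) := by
      intro z
      have h2 : gauss d (r + s) (x + (r + s) • w) z =
          gauss d (r + s) (x + r • w) (z - s • w) := by
        rw [← gauss_add_add _ _ (z - s • w) (s • w), sub_add_cancel, add_smul, add_assoc]
      have h3 : ∀ u, gauss d s (u + s • w) z = gauss d s u (z - s • w) := by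
        intro u
        rw [← gauss_add_add _ u (z - s • w) (s • w), sub_add_cancel]
      rw [h2, ENNReal.ofReal_mul (gauss_nonneg (add_pos hr hs.1) _ _),
        ← lintegral_gauss_mul_gauss hr hs.1, ← lintegral_mul_const' _ _ ENNReal.ofReal_ne_top]
      refine lintegral_congr fun u => ?_
      rw [h3, ENNReal.ofReal_mul (gauss_nonneg hs.1 _ _), mul_assoc]
    simp_rw [h1]
    rw [lintegral_lintegral_swap]
    · refine lintegral_congr fun u => ?_
      rw [lintegral_const_mul' _ _ ENNReal.ofReal_ne_top]
    · refine Measurable.aemeasurable ?_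
      refine Measurable.mul (hg.comp (by fun_prop :
        Measurable fun p : EuclideanSpace ℝ (Fin d) × EuclideanSpace ℝ (Fin d) =>
          (r, x + r • w, p.2))).ennreal_ofReal ?_
      exact ((hg.comp (by fun_prop :
        Measurable fun p : EuclideanSpace ℝ (Fin d) × EuclideanSpace ℝ (Fin d) =>
          (s, p.2 + s • w, p.1))).mul (hV.comp measurable_fst).abs).ennreal_ofReal
  have hshift := setLIntegral_Ioo_comp_const_add
    (fun s => ∫⁻ z, ENNReal.ofReal (gauss d s (x + s • w) z * |V z|)) 0 r r
  rw [add_zero, ← two_mul] at hshift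
  rw [← hshift, setLIntegral_congr_fun measurableSet_Ioo key, lintegral_lintegral_swap]
  · refine lintegral_congr fun u => ?_
    rw [lintegral_const_mul' _ _ ENNReal.ofReal_ne_top, driftPotential]
  · refine Measurable.aemeasurable ?_
    refine Measurable.mul (hg.comp (by fun_prop :
      Measurable fun p : ℝ × EuclideanSpace ℝ (Fin d) => (r, x + r • w, p.2))).ennreal_ofReal ?_
    refine Measurable.lintegral_prod_right' (f := fun q : (ℝ × EuclideanSpace ℝ (Fin d)) ×
      EuclideanSpace ℝ (Fin d) =>
        ENNReal.ofReal (gauss d q.1.1 (q.1.2 + q.1.1 • w) q.2 * |V q.2|)) ?_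
    exact ((hg.comp (by fun_prop :
      Measurable fun q : (ℝ × EuclideanSpace ℝ (Fin d)) × EuclideanSpace ℝ (Fin d) =>
        (q.1.1, q.1.2 + q.1.1 • w, q.2))).mul (hV.comp measurable_snd).abs).ennreal_ofReal

lemma driftPotential_two_mul_le (hV : Measurable V) {r : ℝ} (hr : 0 < r) {M : ℝ≥0∞}
    {w : EuclideanSpace ℝ (Fin d)} (hM : ∀ x, driftPotential d V r x w ≤ M)
    (x : EuclideanSpace ℝ (Fin d)) : driftPotential d V (2 * r) x w ≤ 2 * M := by
  rw [driftPotential, setLIntegral_Ioo_split _ hr (by linarith : r < 2 * r),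
    setLIntegral_Ioo_drift_shift hV hr, two_mul M]
  refine add_le_add (hM x) ?_
  calc ∫⁻ u, ENNReal.ofReal (gauss d r (x + r • w) u) * driftPotential d V r u w
      ≤ ∫⁻ u, ENNReal.ofReal (gauss d r (x + r • w) u) * M := by
        gcongr with u; exact hM u
    _ = M := by
        have hg : Measurable fun u => gauss d r (x + r • w) u :=
          measurable_gauss.comp (by fun_prop : Measurable fun u => (r, x + r • w, u))
        rw [lintegral_mul_const _ hg.ennreal_ofReal, lintegral_gauss hr, one_mul]

lemma driftPotential_mono {r r' : ℝ} (h : r ≤ r') (x w : EuclideanSpace ℝ (Fin d)) :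
    driftPotential d V r x w ≤ driftPotential d V r' x w :=
  lintegral_mono_set (Set.Ioo_subset_Ioo_right h)

lemma bridge_eq {s t : ℝ} (hs : 0 < s) (hst : s < t) (x y z : EuclideanSpace ℝ (Fin d)) :
    gauss d s x z * gauss d (t - s) z y / gauss d t x y =
      gauss d (s * (t - s) / t) (x + s • (t⁻¹ • (y - x))) z := by
  rw [gauss_mul_gauss hs (sub_pos.mpr hst), add_sub_cancel, smul_smul, ← div_eq_mul_inv,
    mul_div_cancel_left₀ _ (gauss_pos (hs.trans hst) x y).ne']

lemma half_le_bridge_time {s t : ℝ} (hs : 0 < s) (hst : s < t / 2) :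
    s / 2 ≤ s * (t - s) / t := by
  rw [le_div_iff₀ (by linarith)]
  nlinarith

lemma bridge_time_le {s t : ℝ} (hs : 0 < s) (hst : s < t / 2) : s * (t - s) / t ≤ s := by
  rw [div_le_iff₀ (by linarith)]
  nlinarith

lemma Sk_eq_add {t : ℝ} (ht : 0 < t) (x y : EuclideanSpace ℝ (Fin d)) :
    Sk d V t x y =
      (∫⁻ s in Set.Ioo 0 (t / 2), ∫⁻ z,
        ENNReal.ofReal (gauss d s x z * gauss d (t - s) z y / gauss d t x y * |V z|)) +
      ∫⁻ s in Set.Ioo 0 (t / 2), ∫⁻ z,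
        ENNReal.ofReal (gauss d s y z * gauss d (t - s) z x / gauss d t y x * |V z|) := by
  rw [Sk, setLIntegral_Ioo_split _ (half_pos ht) (half_lt_self ht)]
  congr 1
  have h := setLIntegral_Ioo_comp_const_sub (fun s => ∫⁻ z,
    ENNReal.ofReal (gauss d s x z * gauss d (t - s) z y / gauss d t x y * |V z|)) 0 (t / 2) t
  rw [sub_zero, sub_half] at h
  rw [← h]
  refine lintegral_congr fun s => lintegral_congr fun z => ?_
  rw [sub_sub_cancel, gauss_symm _ x z, gauss_symm _ z y, gauss_symm _ x y, mul_comm (gauss d _ z x)]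

lemma setLIntegral_bridge_le {t : ℝ} (x y : EuclideanSpace ℝ (Fin d)) :
    ∫⁻ s in Set.Ioo 0 (t / 2), ∫⁻ z,
        ENNReal.ofReal (gauss d s x z * gauss d (t - s) z y / gauss d t x y * |V z|) ≤
      ENNReal.ofReal (2 ^ ((d : ℝ) / 2)) * driftPotential d V (t / 2) x (t⁻¹ • (y - x)) := by
  rw [driftPotential, ← lintegral_const_mul' _ _ ENNReal.ofReal_ne_top]
  refine setLIntegral_mono' measurableSet_Ioo fun s hs => ?_
  rw [← lintegral_const_mul' _ _ ENNReal.ofReal_ne_top]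
  refine lintegral_mono fun z => ?_
  have ht : 0 < t - s := by linarith [hs.1, hs.2]
  rw [bridge_eq hs.1 (by linarith), ← ENNReal.ofReal_mul (by positivity), ← mul_assoc]
  gcongr
  exact gauss_le_of_le (div_pos (mul_pos hs.1 ht) (by linarith [hs.1])) (bridge_time_le hs.1 hs.2)
    (by linarith [half_le_bridge_time hs.1 hs.2]) _ _

lemma driftPotential_le_Sk {t : ℝ} (ht : 0 < t) (x w : EuclideanSpace ℝ (Fin d)) :
    2 * driftPotential d V (t / 4) x ((2 : ℝ) • w) ≤
      ENNReal.ofReal (2 ^ ((d : ℝ) / 2)) * Sk d V t x (x + t • w) := by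
  have h := setLIntegral_Ioo_comp_two_mul
    (fun s => ∫⁻ z, ENNReal.ofReal (gauss d (s / 2) (x + s • w) z * |V z|)) 0 (t / 4)
  have h2 : ∀ s : ℝ, 2 * s / 2 = s := fun s => by ring
  have h3 : ∀ s : ℝ, (2 * s) • w = s • ((2 : ℝ) • w) := fun s => by rw [smul_smul, mul_comm]
  simp only [h2, h3, mul_zero, show 2 * (t / 4) = t / 2 by ring] at h
  rw [driftPotential, ← h, Sk_eq_add ht]
  refine le_trans ?_ (mul_le_mul_right (le_add_of_nonneg_right zero_le) _)
  rw [← lintegral_const_mul' _ _ ENNReal.ofReal_ne_top]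
  refine setLIntegral_mono' measurableSet_Ioo fun s hs => ?_
  rw [← lintegral_const_mul' _ _ ENNReal.ofReal_ne_top]
  refine lintegral_mono fun z => ?_
  rw [bridge_eq hs.1 (by linarith [hs.2]), ← ENNReal.ofReal_mul (by positivity), ← mul_assoc,
    add_sub_cancel_left, inv_smul_smul₀ ht.ne']
  gcongr
  exact gauss_le_of_le (half_pos hs.1) (half_le_bridge_time hs.1 hs.2)
    (by linarith [bridge_time_le hs.1 hs.2]) _ _

lemma driftPotential_le_SNorm (hV : Measurable V) {T : ℝ} (hT : 0 < T)
    (x w : EuclideanSpace ℝ (Fin d)) :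
    driftPotential d V (T / 2) x w ≤ ENNReal.ofReal (2 ^ ((d : ℝ) / 2)) * SNorm d V T := by
  have hM : ∀ u, driftPotential d V (T / 4) u w ≤
      ENNReal.ofReal (2 ^ ((d : ℝ) / 2)) * SNorm d V T / 2 := by
    intro u
    rw [ENNReal.le_div_iff_mul_le (by simp) (by simp), mul_comm]
    have h := driftPotential_le_Sk (V := V) hT u ((2 : ℝ)⁻¹ • w)
    rw [smul_inv_smul₀ two_ne_zero] at h
    refine h.trans ?_
    gcongr
    exact le_iSup₂ (f := fun x y => Sk d V T x y) u _
  have h := driftPotential_two_mul_le hV (by positivity : 0 < T / 4) hM x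
  rwa [show 2 * (T / 4) = T / 2 by ring, ENNReal.mul_div_cancel (by simp) (by simp)] at h

lemma Sk_le_SNorm (hV : Measurable V) {t T : ℝ} (ht : 0 < t) (htT : t ≤ T)
    (x y : EuclideanSpace ℝ (Fin d)) :
    Sk d V t x y ≤ ENNReal.ofReal (2 ^ (d + 1)) * SNorm d V T := by
  have hT := ht.trans_le htT
  have hhalf : ∀ x y, ∫⁻ s in Set.Ioo 0 (t / 2), ∫⁻ z,
      ENNReal.ofReal (gauss d s x z * gauss d (t - s) z y / gauss d t x y * |V z|) ≤
        ENNReal.ofReal (2 ^ d) * SNorm d V T := by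
    intro x y
    refine (setLIntegral_bridge_le x y).trans ?_
    have hc : (2 : ℝ) ^ d = 2 ^ ((d : ℝ) / 2) * 2 ^ ((d : ℝ) / 2) := by
      rw [← Real.rpow_add two_pos, add_halves, Real.rpow_natCast]
    rw [hc, ENNReal.ofReal_mul (by positivity), mul_assoc]
    gcongr
    exact (driftPotential_mono (by linarith) _ _).trans (driftPotential_le_SNorm hV hT _ _)
  rw [Sk_eq_add ht]
  refine (add_le_add (hhalf x y) (hhalf y x)).trans_eq ?_
  rw [← two_mul, ← mul_assoc, pow_succ, mul_comm ((2 : ℝ) ^ d), ENNReal.ofReal_mul two_pos.le]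
  simp

end Drift

/-- The time integral up to `r` of `|V|` against the unnormalized heat kernel started at `y` with
drift `-w`. -/
noncomputable def NHalf (d : ℕ) (V : EuclideanSpace ℝ (Fin d) → ℝ) (r : ℝ)
    (y w : EuclideanSpace ℝ (Fin d)) : ℝ≥0∞ :=
  ∫⁻ τ in Set.Ioo (0 : ℝ) r, ∫⁻ z, ENNReal.ofReal
    (τ ^ (-(d : ℝ) / 2) * Real.exp (-‖z - y + τ • w‖ ^ 2 / (4 * τ)) * |V z|)

section NHalf

variable {d : ℕ} {V : EuclideanSpace ℝ (Fin d) → ℝ}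

lemma Nk_eq_add {t : ℝ} (ht : 0 < t) (x y : EuclideanSpace ℝ (Fin d)) :
    Nk d V t x y = NHalf d V (t / 2) y (t⁻¹ • (y - x)) + NHalf d V (t / 2) x (t⁻¹ • (x - y)) := by
  rw [Nk, NHalf, NHalf]
  congr 1
  · simp_rw [smul_smul, ← div_eq_mul_inv]
  · have h := setLIntegral_Ioo_comp_const_sub (fun τ => ∫⁻ z, ENNReal.ofReal
      ((t - τ) ^ (-(d : ℝ) / 2) *
        Real.exp (-‖z - y + (τ / t) • (y - x)‖ ^ 2 / (4 * (t - τ))) * |V z|)) 0 (t / 2) t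
    rw [sub_zero, sub_half] at h
    rw [← h]
    refine lintegral_congr fun τ => lintegral_congr fun z => ?_
    have hv : z - y + ((t - τ) / t) • (y - x) = z - x + τ • (t⁻¹ • (x - y)) := by
      rw [sub_div, div_self ht.ne', sub_smul, one_smul, smul_smul, ← div_eq_mul_inv,
        ← neg_sub x y, smul_neg]
      abel
    rw [sub_sub_cancel, hv]

lemma NHalf_le_NNorm {t T : ℝ} (hT : 0 < T) (htT : t ≤ T) (y w : EuclideanSpace ℝ (Fin d)) :
    NHalf d V (t / 2) y w ≤ NNorm d V T := by
  have h : NHalf d V (T / 2) y w ≤ Nk d V T (y - T • w) y := by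
    rw [Nk_eq_add hT, sub_sub_cancel, inv_smul_smul₀ hT.ne']
    exact le_add_of_nonneg_right zero_le
  refine le_trans ?_ (h.trans (le_iSup₂ (f := fun x y => Nk d V T x y) _ _))
  exact lintegral_mono_set (Set.Ioo_subset_Ioo_right (by linarith))

end NHalf

theorem stmt10 (d : ℕ) (hd : 1 ≤ d) :
    (∀ T : ℝ, 0 < T → ∀ V : EuclideanSpace ℝ (Fin d) → ℝ, Measurable V →
      NNorm d V T ≤ NNormT d V T ∧ NNormT d V T ≤ 2 * NNorm d V T) ∧
    ∃ C : ℝ, 0 < C ∧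
      ∀ T : ℝ, 0 < T → ∀ V : EuclideanSpace ℝ (Fin d) → ℝ, Measurable V →
        SNorm d V T ≤ SNormT d V T ∧ SNormT d V T ≤ ENNReal.ofReal C * SNorm d V T := by
  refine ⟨fun T hT V _ => ⟨?_, ?_⟩, 2 ^ (d + 1), by positivity, fun T hT V hV => ⟨?_, ?_⟩⟩
  · exact le_iSup₂ (f := fun t (_ : t ∈ Set.Ioc 0 T) => NNorm d V t) T ⟨hT, le_rfl⟩
  · refine iSup₂_le fun t ht => iSup₂_le fun x y => ?_
    rw [Nk_eq_add ht.1, two_mul]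
    exact add_le_add (NHalf_le_NNorm hT ht.2 _ _) (NHalf_le_NNorm hT ht.2 _ _)
  · exact le_iSup₂ (f := fun t (_ : t ∈ Set.Ioc 0 T) => SNorm d V t) T ⟨hT, le_rfl⟩
  · exact iSup₂_le fun t ht => iSup₂_le fun x y => Sk_le_SNorm hV ht.1 ht.2 x y
end

section
/- Let d = 1. There exist constants C₁, C₂ > 0 such that for every t > 0 and every Borel measurable V : ℝ → ℝ, C₁ · A(t) ≤ sup_{x∈ℝ} √t · ∫_{|z-x| < √(4t)} |V(z)| dz ≤ C₂ · A(t), where A(t) = sup_{x∈ℝ} ∫_0^t ∫_{ℝ} g(s,x,z)|V(z)| dz ds. -/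
open MeasureTheory Filter
open scoped ENNReal

/-- The Gauss-Weierstrass kernel on `ℝ` (dimension 1). -/
noncomputable def gauss1 (t x y : ℝ) : ℝ :=
  (4 * Real.pi * t) ^ (-(1 : ℝ) / 2) * Real.exp (-(y - x) ^ 2 / (4 * t))

/-- `S(V,t,x,y)` in dimension 1. -/
noncomputable def Sk1 (V : ℝ → ℝ) (t x y : ℝ) : ℝ≥0∞ :=
  ∫⁻ s in Set.Ioo (0 : ℝ) t, ∫⁻ z,
    ENNReal.ofReal (gauss1 s x z * gauss1 (t - s) z y / gauss1 t x y * |V z|)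

/-- `‖S(V,t)‖_∞` in dimension 1. -/
noncomputable def SNorm1 (V : ℝ → ℝ) (t : ℝ) : ℝ≥0∞ :=
  ⨆ x, ⨆ y, Sk1 V t x y

/-- `‖S(V)‖_{T,∞}` in dimension 1. -/
noncomputable def SNormT1 (V : ℝ → ℝ) (T : ℝ) : ℝ≥0∞ :=
  ⨆ t ∈ Set.Ioc (0 : ℝ) T, SNorm1 V t

/-- `sup_x ∫_0^t ∫ g(s,x,z)|V(z)| dz ds` in dimension 1. -/
noncomputable def katoA1 (V : ℝ → ℝ) (t : ℝ) : ℝ≥0∞ :=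
  ⨆ x, ∫⁻ s in Set.Ioo (0 : ℝ) t, ∫⁻ z, ENNReal.ofReal (gauss1 s x z * |V z|)

lemma gauss1_le {s t : ℝ} (hs : 0 < s) (hst : s < t) (x z : ℝ) :
    gauss1 s x z ≤ s ^ (-(1 : ℝ) / 2) * Real.exp (-(z - x) ^ 2 / (4 * t)) := by
  unfold gauss1
  have hπ := Real.pi_gt_three
  refine mul_le_mul ?_ ?_ (Real.exp_pos _).le (Real.rpow_nonneg hs.le _)
  · exact Real.rpow_le_rpow_of_nonpos hs (by nlinarith) (by norm_num)
  · rw [Real.exp_le_exp, neg_div, neg_div, neg_le_neg_iff]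
    exact div_le_div_of_nonneg_left (sq_nonneg _) (by positivity) (by linarith)

lemma le_gauss1 {s t x z : ℝ} (ht : 0 < t) (hs : t / 2 < s) (hst : s < t)
    (hz : |z - x| < √(4 * t)) :
    (4 * √t)⁻¹ * Real.exp (-2) ≤ gauss1 s x z := by
  unfold gauss1
  have hs0 : 0 < s := by linarith
  have hz2 : (z - x) ^ 2 < 4 * t := by
    rw [← sq_abs]
    exact (Real.lt_sqrt (abs_nonneg _)).1 hz
  have h1 : (4 * √t)⁻¹ = (16 * t) ^ (-(1 : ℝ) / 2) := by
    rw [neg_div, Real.rpow_neg (by positivity), ← Real.sqrt_eq_rpow,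
      Real.sqrt_mul (by norm_num), show (16 : ℝ) = 4 ^ 2 by norm_num,
      Real.sqrt_sq (by norm_num)]
  have hπ := Real.pi_le_four
  have hπ0 := Real.pi_pos
  refine mul_le_mul ?_ ?_ (Real.exp_pos _).le (by positivity)
  · rw [h1]
    exact Real.rpow_le_rpow_of_nonpos (by positivity) (by nlinarith) (by norm_num)
  · rw [Real.exp_le_exp, le_div_iff₀ (by positivity)]
    linarith

lemma lintegral_rpow_neg_half {t : ℝ} (ht : 0 < t) :
    ∫⁻ s in Set.Ioo (0 : ℝ) t, ENNReal.ofReal (s ^ (-(1 : ℝ) / 2)) =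
      ENNReal.ofReal (2 * √t) := by
  have hint : IntervalIntegrable (fun s : ℝ => s ^ (-(1 : ℝ) / 2)) volume 0 t :=
    intervalIntegral.intervalIntegrable_rpow' (by norm_num)
  rw [intervalIntegrable_iff_integrableOn_Ioo_of_le ht.le] at hint
  rw [← ofReal_integral_eq_lintegral_ofReal hint
      (ae_restrict_of_forall_mem measurableSet_Ioo fun s hs => Real.rpow_nonneg hs.1.le _),
    ← integral_Ioc_eq_integral_Ioo, ← intervalIntegral.integral_of_le ht.le,
    integral_rpow (Or.inl (by norm_num)), Real.sqrt_eq_rpow]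
  congr 1
  norm_num
  ring

lemma tsum_ofReal_exp_neg_abs_ne_top :
    ∑' n : ℤ, ENNReal.ofReal (Real.exp (2 - |(n : ℝ)|)) ≠ ⊤ := by
  have hnat : Summable fun n : ℕ => Real.exp (2 - n) := by
    simpa [Real.exp_sub, Real.exp_neg, div_eq_mul_inv] using
      Real.summable_exp_neg_nat.mul_left (Real.exp 2)
  refine Summable.tsum_ofReal_ne_top (Summable.of_nat_of_neg ?_ ?_) <;> simpa using hnat

/-- A Gaussian is dominated by a summable combination of indicators of overlapping unit balls
centred at the integers. -/
lemma exp_neg_sq_le_tsum_indicator (u : ℝ) :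
    ENNReal.ofReal (Real.exp (-u ^ 2)) ≤
      ∑' n : ℤ, ENNReal.ofReal (Real.exp (2 - |(n : ℝ)|)) *
        {v : ℝ | |v - n| < 1}.indicator 1 u := by
  refine le_trans ?_ (ENNReal.le_tsum ⌊u⌋)
  have h0 := Int.floor_le u
  have h1 := Int.lt_floor_add_one u
  have hmem : u ∈ {v : ℝ | |v - (⌊u⌋ : ℝ)| < 1} := by
    rw [Set.mem_ofPred_eq, abs_lt]
    constructor <;> linarith
  rw [Set.indicator_of_mem hmem, Pi.one_apply, mul_one]
  refine ENNReal.ofReal_le_ofReal (Real.exp_le_exp.2 ?_)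
  have h2 : |(⌊u⌋ : ℝ)| ≤ |u| + 1 := by
    have := abs_sub_abs_le_abs_sub (⌊u⌋ : ℝ) u
    rw [abs_sub_comm] at this
    have := hmem.out
    linarith
  nlinarith [sq_abs u, sq_nonneg (|u| - 1), abs_nonneg u]

lemma lintegral_gaussian_mul_le {t : ℝ} (ht : 0 < t) {V : ℝ → ℝ} (hV : Measurable V) (x : ℝ) :
    ∫⁻ z, ENNReal.ofReal (Real.exp (-(z - x) ^ 2 / (4 * t))) * ENNReal.ofReal |V z| ≤
      (∑' n : ℤ, ENNReal.ofReal (Real.exp (2 - |(n : ℝ)|))) *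
        ⨆ y : ℝ, ∫⁻ z in {z : ℝ | |z - y| < √(4 * t)}, ENNReal.ofReal |V z| := by
  set R := √(4 * t) with hR
  have hR0 : 0 < R := Real.sqrt_pos.2 (by positivity)
  have hRsq : R ^ 2 = 4 * t := Real.sq_sqrt (by positivity)
  have hmeas (y : ℝ) : MeasurableSet {z : ℝ | |z - y| < R} :=
    measurableSet_lt (by fun_prop) measurable_const
  have hVm : Measurable fun z => ENNReal.ofReal |V z| := by fun_prop
  have hset (n : ℤ) (z : ℝ) : {v : ℝ | |v - n| < 1}.indicator (1 : ℝ → ℝ≥0∞) ((z - x) / R) =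
      {z : ℝ | |z - (x + n * R)| < R}.indicator 1 z := by
    have : (z - x) / R - n = (z - (x + n * R)) / R := by field_simp; ring
    simp only [Set.indicator_apply, Set.mem_ofPred_eq, this, abs_div, abs_of_pos hR0,
      div_lt_one hR0, Pi.one_apply]
  calc
    _ ≤ ∫⁻ z, ∑' n : ℤ, ENNReal.ofReal (Real.exp (2 - |(n : ℝ)|)) *
          {z : ℝ | |z - (x + n * R)| < R}.indicator (fun z => ENNReal.ofReal |V z|) z := by
      refine lintegral_mono fun z => ?_
      have h := exp_neg_sq_le_tsum_indicator ((z - x) / R)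
      rw [div_pow, hRsq, ← neg_div] at h
      refine (mul_le_mul_left h _).trans_eq ?_
      rw [← ENNReal.tsum_mul_right]
      refine tsum_congr fun n => ?_
      rw [hset, mul_assoc]
      congr 1
      by_cases hz : z ∈ {z : ℝ | |z - (x + n * R)| < R} <;> simp [hz]
    _ = ∑' n : ℤ, ENNReal.ofReal (Real.exp (2 - |(n : ℝ)|)) *
          ∫⁻ z in {z : ℝ | |z - (x + n * R)| < R}, ENNReal.ofReal |V z| := by
      rw [lintegral_tsum fun n => ((hVm.indicator (hmeas _)).const_mul _).aemeasurable]
      refine tsum_congr fun n => ?_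
      rw [lintegral_const_mul _ (hVm.indicator (hmeas _)), lintegral_indicator (hmeas _)]
    _ ≤ _ := by
      rw [← ENNReal.tsum_mul_right]
      refine ENNReal.tsum_le_tsum fun n => ?_
      gcongr
      exact le_iSup (fun y : ℝ => ∫⁻ z in {z : ℝ | |z - y| < R}, ENNReal.ofReal |V z|) _

lemma katoA1_le {t : ℝ} (ht : 0 < t) {V : ℝ → ℝ} (hV : Measurable V) :
    katoA1 V t ≤ ENNReal.ofReal (2 * √t) *
      ((∑' n : ℤ, ENNReal.ofReal (Real.exp (2 - |(n : ℝ)|))) *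
        ⨆ y : ℝ, ∫⁻ z in {z : ℝ | |z - y| < √(4 * t)}, ENNReal.ofReal |V z|) := by
  refine iSup_le fun x => ?_
  have hm : Measurable fun s : ℝ => ENNReal.ofReal (s ^ (-(1 : ℝ) / 2)) := by fun_prop
  rw [← lintegral_rpow_neg_half ht, ← lintegral_mul_const _ hm]
  refine setLIntegral_mono' measurableSet_Ioo fun s hs => ?_
  calc
    _ ≤ ∫⁻ z, ENNReal.ofReal (s ^ (-(1 : ℝ) / 2)) *
          (ENNReal.ofReal (Real.exp (-(z - x) ^ 2 / (4 * t))) * ENNReal.ofReal |V z|) := by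
      refine lintegral_mono fun z => ?_
      rw [← ENNReal.ofReal_mul (Real.exp_pos _).le,
        ← ENNReal.ofReal_mul (Real.rpow_nonneg hs.1.le _), ← mul_assoc]
      exact ENNReal.ofReal_le_ofReal
        (mul_le_mul_of_nonneg_right (gauss1_le hs.1 hs.2 x z) (abs_nonneg _))
    _ ≤ _ := by
      rw [lintegral_const_mul _ (by fun_prop)]
      gcongr
      exact lintegral_gaussian_mul_le ht hV x

lemma le_katoA1 {t : ℝ} (ht : 0 < t) (V : ℝ → ℝ) (x : ℝ) :
    ENNReal.ofReal (√t * Real.exp (-2) / 8) *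
        ∫⁻ z in {z : ℝ | |z - x| < √(4 * t)}, ENNReal.ofReal |V z| ≤ katoA1 V t := by
  set c := (4 * √t)⁻¹ * Real.exp (-2) with hc
  have hc0 : 0 ≤ c := by positivity
  have hmeas : MeasurableSet {z : ℝ | |z - x| < √(4 * t)} :=
    measurableSet_lt (by fun_prop) measurable_const
  have hconst : √t * Real.exp (-2) / 8 = (t - t / 2) * c := by
    have h0 : 0 < √t := Real.sqrt_pos.2 ht
    rw [hc]
    field_simp
    linarith [Real.sq_sqrt ht.le]
  calc
    _ = ∫⁻ _ in Set.Ioo (t / 2) t, ENNReal.ofReal c *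
          ∫⁻ z in {z : ℝ | |z - x| < √(4 * t)}, ENNReal.ofReal |V z| := by
      rw [setLIntegral_const, Real.volume_Ioo, hconst, ENNReal.ofReal_mul (by linarith)]
      ring
    _ ≤ ∫⁻ s in Set.Ioo (t / 2) t, ∫⁻ z, ENNReal.ofReal (gauss1 s x z * |V z|) := by
      refine setLIntegral_mono' measurableSet_Ioo fun s hs => ?_
      rw [← lintegral_const_mul' _ _ ENNReal.ofReal_ne_top]
      refine (setLIntegral_mono' hmeas fun z hz => ?_).trans (setLIntegral_le_lintegral _ _)
      rw [← ENNReal.ofReal_mul hc0]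
      exact ENNReal.ofReal_le_ofReal
        (mul_le_mul_of_nonneg_right (le_gauss1 ht hs.1 hs.2 hz) (abs_nonneg _))
    _ ≤ ∫⁻ s in Set.Ioo 0 t, ∫⁻ z, ENNReal.ofReal (gauss1 s x z * |V z|) :=
      lintegral_mono_set (Set.Ioo_subset_Ioo_left (by linarith))
    _ ≤ _ := le_iSup (fun x => ∫⁻ s in Set.Ioo 0 t, ∫⁻ z, ENNReal.ofReal (gauss1 s x z * |V z|)) x

theorem stmt13 :
    ∃ C₁ C₂ : ℝ, 0 < C₁ ∧ 0 < C₂ ∧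
    ∀ t : ℝ, 0 < t → ∀ V : ℝ → ℝ, Measurable V →
      ENNReal.ofReal C₁ * katoA1 V t ≤
        (⨆ x : ℝ, ENNReal.ofReal (Real.sqrt t) *
          ∫⁻ z in {z : ℝ | |z - x| < Real.sqrt (4 * t)}, ENNReal.ofReal |V z|) ∧
      (⨆ x : ℝ, ENNReal.ofReal (Real.sqrt t) *
          ∫⁻ z in {z : ℝ | |z - x| < Real.sqrt (4 * t)}, ENNReal.ofReal |V z|) ≤
        ENNReal.ofReal C₂ * katoA1 V t := by
  set K := (∑' n : ℤ, ENNReal.ofReal (Real.exp (2 - |(n : ℝ)|))).toReal with hK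
  have hKofReal : ENNReal.ofReal K = ∑' n : ℤ, ENNReal.ofReal (Real.exp (2 - |(n : ℝ)|)) :=
    ENNReal.ofReal_toReal tsum_ofReal_exp_neg_abs_ne_top
  have hK0 : 0 < K := by
    rw [← ENNReal.ofReal_pos, hKofReal]
    exact (ENNReal.ofReal_pos.2 (Real.exp_pos _)).trans_le (ENNReal.le_tsum 0)
  refine ⟨(2 * K)⁻¹, 8 * Real.exp 2, by positivity, by positivity, fun t ht V hV => ⟨?_, ?_⟩⟩
  · refine (mul_le_mul_right (katoA1_le ht hV) _).trans_eq ?_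
    rw [← ENNReal.mul_iSup, ← hKofReal, ← mul_assoc, ← mul_assoc,
      ← ENNReal.ofReal_mul (by positivity), ← ENNReal.ofReal_mul (by positivity)]
    congr 2
    field_simp
  · refine iSup_le fun x => ?_
    refine le_trans (le_of_eq ?_) (mul_le_mul_right (le_katoA1 ht V x) _)
    rw [← mul_assoc, ← ENNReal.ofReal_mul (by positivity)]
    congr 2
    rw [Real.exp_neg]
    field_simp
end

section
/- Let d ≥ 2. For all t > 0 and all α, x, z ∈ ℝ^d satisfying |z - x| ≤ 2|α|t, one has (1/2) ∫_0^∞ p_α(s,x,z) ds ≤ ∫_0^t p_α(s,x,z) ds ≤ ∫_0^∞ p_α(s,x,z) ds. -/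
open MeasureTheory Filter
open scoped ENNReal

lemma pk_eq (d : ℕ) (α x z : EuclideanSpace ℝ (Fin d)) {s : ℝ} (hs : 0 < s) :
    pk d α s x z = (4 * Real.pi * s) ^ (-(d : ℝ) / 2) *
      Real.exp (-(‖z - x‖ ^ 2 / (4 * s)) - inner ℝ (z - x) α - ‖α‖ ^ 2 * s) := by
  have hnorm : ‖z - (x - (2 * s) • α)‖ ^ 2 =
      ‖z - x‖ ^ 2 + 4 * s * inner ℝ (z - x) α + 4 * s ^ 2 * ‖α‖ ^ 2 := by
    rw [← sub_add, norm_add_sq_real, inner_smul_right, norm_smul, mul_pow, Real.norm_eq_abs,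
      sq_abs]
    ring
  unfold pk gauss
  rw [hnorm]
  congr 2
  field_simp
  ring

/-- The diagonal potential over `(0, t)` diverges in dimension at least two. -/
lemma lintegral_pk_self (d : ℕ) (hd : 2 ≤ d) {t : ℝ} (ht : 0 < t)
    (α x : EuclideanSpace ℝ (Fin d)) :
    ∫⁻ s in Set.Ioo (0 : ℝ) t, ENNReal.ofReal (pk d α s x x) = ∞ := by
  set c : ℝ := (4 * Real.pi) ^ (-(d : ℝ) / 2) * Real.exp (-(‖α‖ ^ 2 * t)) with hc
  have hc0 : 0 < c := by positivity
  have hle : ∀ s ∈ Set.Ioo (0 : ℝ) t, c * s ^ (-(d : ℝ) / 2) ≤ pk d α s x x := by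
    intro s hs
    have h0 : 0 < s := hs.1
    rw [pk_eq d α x x h0, Real.mul_rpow (by positivity) h0.le, hc, mul_right_comm]
    gcongr
    simp only [sub_self, norm_zero, inner_zero_left, ne_eq, OfNat.ofNat_ne_zero,
      not_false_eq_true, zero_pow, zero_div, neg_zero, zero_sub, neg_le_neg_iff]
    exact mul_le_mul_of_nonneg_left hs.2.le (sq_nonneg _)
  by_contra hfin
  have hlt : ∫⁻ s in Set.Ioo (0 : ℝ) t, ENNReal.ofReal (c * s ^ (-(d : ℝ) / 2)) < ∞ :=
    (setLIntegral_mono' measurableSet_Ioo fun s hs => ENNReal.ofReal_le_ofReal (hle s hs)).trans_lt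
      (lt_top_iff_ne_top.2 hfin)
  have hint : IntegrableOn (fun s : ℝ => c * s ^ (-(d : ℝ) / 2)) (Set.Ioo 0 t) := by
    refine ⟨by fun_prop, ?_⟩
    rw [hasFiniteIntegral_iff_ofReal]
    · exact hlt
    · filter_upwards [ae_restrict_mem measurableSet_Ioo] with s hs
      have h0 : 0 < s := hs.1
      positivity
  have hint' : IntegrableOn (fun s : ℝ => s ^ (-(d : ℝ) / 2)) (Set.Ioo 0 t) := by
    have := hint.const_mul c⁻¹
    simpa [IntegrableOn, ← mul_assoc, inv_mul_cancel₀ hc0.ne'] using this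
  have h1 := (intervalIntegral.integrableOn_Ioo_rpow_iff ht).1 hint'
  have h2 : (2 : ℝ) ≤ d := by exact_mod_cast hd
  linarith

/-- Pointwise comparison under the inversion `s ↦ τ ^ 2 / s`. -/
lemma pk_le_inversion (d : ℕ) (hd : 2 ≤ d) (α x z : EuclideanSpace ℝ (Fin d)) {τ s : ℝ}
    (hτ : 0 < τ) (hs : τ < s) (h : ‖z - x‖ = 2 * ‖α‖ * τ) :
    pk d α s x z ≤ |-(τ ^ 2 / s ^ 2)| * pk d α (τ ^ 2 / s) x z := by
  have h0 : 0 < s := hτ.trans hs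
  have hd' : (0 : ℝ) ≤ d - 2 := by
    have : (2 : ℝ) ≤ d := by exact_mod_cast hd
    linarith
  rw [pk_eq d α x z h0, pk_eq d α x z (by positivity : 0 < τ ^ 2 / s), abs_neg,
    abs_of_nonneg (by positivity), ← mul_assoc, h]
  have hexp : -((2 * ‖α‖ * τ) ^ 2 / (4 * (τ ^ 2 / s))) - inner ℝ (z - x) α
      - ‖α‖ ^ 2 * (τ ^ 2 / s) =
      -((2 * ‖α‖ * τ) ^ 2 / (4 * s)) - inner ℝ (z - x) α - ‖α‖ ^ 2 * s := by
    field_simp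
    ring
  rw [hexp]
  gcongr
  rw [Real.mul_rpow (by positivity : 0 ≤ 4 * Real.pi) h0.le,
    Real.mul_rpow (by positivity : 0 ≤ 4 * Real.pi) (by positivity : 0 ≤ τ ^ 2 / s),
    mul_left_comm]
  gcongr
  have hratio : τ ^ 2 / s ^ 2 * (τ ^ 2 / s) ^ (-(d : ℝ) / 2) =
      s ^ (-(d : ℝ) / 2) * (s / τ) ^ ((d : ℝ) - 2) := by
    rw [Real.div_rpow (by positivity) h0.le, Real.div_rpow h0.le hτ.le, ← Real.rpow_natCast τ 2,
      ← Real.rpow_mul hτ.le, ← Real.rpow_natCast s 2]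
    have e1 : s ^ ((d : ℝ) - 2) = (s ^ ((d : ℝ) / 2)) ^ 2 / s ^ (2 : ℝ) := by
      rw [Real.rpow_sub h0, ← Real.rpow_natCast, ← Real.rpow_mul h0.le]
      congr 2
      push_cast
      ring
    have e2 : τ ^ ((d : ℝ) - 2) = τ ^ (d : ℝ) / τ ^ (2 : ℝ) := Real.rpow_sub hτ _ _
    have e3 : s ^ (-(d : ℝ) / 2) = (s ^ ((d : ℝ) / 2))⁻¹ := by
      rw [← Real.rpow_neg h0.le, neg_div]
    have e4 : τ ^ (((2 : ℕ) : ℝ) * (-(d : ℝ) / 2)) = (τ ^ (d : ℝ))⁻¹ := by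
      rw [← Real.rpow_neg hτ.le]
      congr 1
      push_cast
      ring
    rw [e1, e2, e3, e4]
    push_cast
    have := Real.rpow_pos_of_pos h0 ((d : ℝ) / 2)
    have := Real.rpow_pos_of_pos h0 2
    have := Real.rpow_pos_of_pos hτ (d : ℝ)
    have := Real.rpow_pos_of_pos hτ 2
    field_simp
  rw [hratio]
  exact le_mul_of_one_le_right (by positivity)
    (Real.one_le_rpow ((one_le_div hτ).2 hs.le) hd')

lemma lintegral_pk_Ioi_le (d : ℕ) (hd : 2 ≤ d) (α x z : EuclideanSpace ℝ (Fin d)) {τ : ℝ}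
    (hτ : 0 < τ) (h : ‖z - x‖ = 2 * ‖α‖ * τ) :
    ∫⁻ s in Set.Ioi τ, ENNReal.ofReal (pk d α s x z) ≤
      ∫⁻ s in Set.Ioo (0 : ℝ) τ, ENNReal.ofReal (pk d α s x z) := by
  have himage : (fun s : ℝ => τ ^ 2 / s) '' Set.Ioi τ ⊆ Set.Ioo 0 τ := by
    rintro _ ⟨s, hs, rfl⟩
    have hs' : τ < s := hs
    have h0 : 0 < s := hτ.trans hs'
    refine ⟨by positivity, ?_⟩
    show τ ^ 2 / s < τ
    rw [div_lt_iff₀ h0]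
    nlinarith
  have hderiv : ∀ s ∈ Set.Ioi τ,
      HasDerivWithinAt (fun s : ℝ => τ ^ 2 / s) (-(τ ^ 2 / s ^ 2)) (Set.Ioi τ) s := by
    intro s hs
    have h0 : s ≠ 0 := (hτ.trans hs).ne'
    have := ((hasDerivAt_inv h0).const_mul (τ ^ 2)).hasDerivWithinAt (s := Set.Ioi τ)
    simpa only [div_eq_mul_inv, mul_neg] using this
  have hinj : Set.InjOn (fun s : ℝ => τ ^ 2 / s) (Set.Ioi τ) := by
    intro a _ b _ hab
    exact inv_injective (mul_left_cancel₀ (pow_ne_zero 2 hτ.ne') hab)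
  calc ∫⁻ s in Set.Ioi τ, ENNReal.ofReal (pk d α s x z)
      ≤ ∫⁻ s in Set.Ioi τ, ENNReal.ofReal |-(τ ^ 2 / s ^ 2)| *
          ENNReal.ofReal (pk d α (τ ^ 2 / s) x z) := by
        refine setLIntegral_mono' measurableSet_Ioi fun s hs => ?_
        rw [← ENNReal.ofReal_mul (abs_nonneg _)]
        exact ENNReal.ofReal_le_ofReal (pk_le_inversion d hd α x z hτ hs h)
    _ = ∫⁻ s in (fun s : ℝ => τ ^ 2 / s) '' Set.Ioi τ, ENNReal.ofReal (pk d α s x z) :=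
        (lintegral_image_eq_lintegral_abs_deriv_mul measurableSet_Ioi hderiv hinj
          fun s => ENNReal.ofReal (pk d α s x z)).symm
    _ ≤ _ := lintegral_mono_set himage

theorem stmt14 (d : ℕ) (hd : 2 ≤ d) (t : ℝ) (ht : 0 < t)
    (α x z : EuclideanSpace ℝ (Fin d)) (h : ‖z - x‖ ≤ 2 * ‖α‖ * t) :
    (1 / 2 : ℝ≥0∞) * (∫⁻ s in Set.Ioi (0 : ℝ), ENNReal.ofReal (pk d α s x z)) ≤
      (∫⁻ s in Set.Ioo (0 : ℝ) t, ENNReal.ofReal (pk d α s x z)) ∧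
    (∫⁻ s in Set.Ioo (0 : ℝ) t, ENNReal.ofReal (pk d α s x z)) ≤
      ∫⁻ s in Set.Ioi (0 : ℝ), ENNReal.ofReal (pk d α s x z) := by
  refine ⟨?_, lintegral_mono_set Set.Ioo_subset_Ioi_self⟩
  rcases eq_or_ne z x with rfl | hzx
  · rw [lintegral_pk_self d hd ht]
    exact le_top
  have hr : 0 < ‖z - x‖ := norm_pos_iff.2 (sub_ne_zero.2 hzx)
  have ha : 0 < ‖α‖ := by
    by_contra hα
    have : ‖α‖ = 0 := le_antisymm (not_lt.1 hα) (norm_nonneg _)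
    rw [this] at h
    linarith
  obtain ⟨τ, hτ, hττ⟩ : ∃ τ : ℝ, 0 < τ ∧ ‖z - x‖ = 2 * ‖α‖ * τ :=
    ⟨‖z - x‖ / (2 * ‖α‖), by positivity, by field_simp⟩
  have hτt : τ ≤ t := by
    rw [hττ] at h
    exact le_of_mul_le_mul_left h (by positivity)
  have htail : ∫⁻ s in Set.Ici t, ENNReal.ofReal (pk d α s x z) ≤
      ∫⁻ s in Set.Ioo (0 : ℝ) t, ENNReal.ofReal (pk d α s x z) := by
    rw [setLIntegral_congr Ioi_ae_eq_Ici.symm]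
    exact (lintegral_mono_set (Set.Ioi_subset_Ioi hτt)).trans
      ((lintegral_pk_Ioi_le d hd α x z hτ hττ).trans
        (lintegral_mono_set (Set.Ioo_subset_Ioo_right hτt)))
  rw [← Set.Ioo_union_Ici_eq_Ioi ht]
  calc _ ≤ (1 / 2 : ℝ≥0∞) * (2 * ∫⁻ s in Set.Ioo (0 : ℝ) t, ENNReal.ofReal (pk d α s x z)) := by
        gcongr
        rw [two_mul]
        exact (lintegral_union_le _ _ _).trans (add_le_add_right htail _)
    _ = _ := by
        rw [← mul_assoc, one_div, ENNReal.inv_mul_cancel (by simp) (by simp), one_mul]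
end

section
/- Let d = 1. For all t > 0 and all α, x, z ∈ ℝ satisfying |z - x| ≤ 2|α|t, one has (e/(e+1)) ∫_0^∞ e^{-s/t} p_α(s,x,z) ds ≤ ∫_0^t p_α(s,x,z) ds ≤ e · ∫_0^∞ e^{-s/t} p_α(s,x,z) ds. -/
open MeasureTheory Filter
open scoped ENNReal

/-- The kernel `p_α(t,x,y) = g(t, x - 2αt, y)` in dimension 1. -/
noncomputable def pk1 (α t x y : ℝ) : ℝ :=
  gauss1 t (x - 2 * t * α) y

/-- The kernel is nonnegative at positive times. -/
lemma pk1_nonneg {s : ℝ} (hs : 0 < s) (α x z : ℝ) : 0 ≤ pk1 α s x z := by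
  unfold pk1 gauss1
  positivity

/-- Reflecting the time `u ≤ t` to `t ^ 2 / u ≥ t` decreases the kernel by at least the factor
`u / t`, provided `|z - x| ≤ 2 * |α| * t`. -/
lemma pk1_reflect_le {t u α x z : ℝ} (hu : 0 < u) (hut : u ≤ t)
    (h : |z - x| ≤ 2 * |α| * t) :
    t / u * pk1 α (t ^ 2 / u) x z ≤ pk1 α u x z := by
  have ht : 0 < t := hu.trans_le hut
  have hw : (z - x) ^ 2 ≤ 4 * α ^ 2 * t ^ 2 := by
    have := pow_le_pow_left₀ (abs_nonneg _) h 2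
    rw [sq_abs, mul_pow, mul_pow, sq_abs] at this
    linarith
  have hpow : t / u * (4 * Real.pi * (t ^ 2 / u)) ^ (-(1 : ℝ) / 2) =
      (4 * Real.pi * u) ^ (-(1 : ℝ) / 2) := by
    have hq : 0 < t / u := by positivity
    have e : 4 * Real.pi * (t ^ 2 / u) = 4 * Real.pi * u * (t / u) ^ 2 := by
      field_simp
    rw [e, Real.mul_rpow (by positivity) (by positivity), ← Real.rpow_natCast (t / u) 2,
      ← Real.rpow_mul hq.le]
    norm_num [Real.rpow_neg_one]
    field_simp
  have hexp : -(z - (x - 2 * (t ^ 2 / u) * α)) ^ 2 / (4 * (t ^ 2 / u)) ≤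
      -(z - (x - 2 * u * α)) ^ 2 / (4 * u) := by
    have e : -(z - (x - 2 * u * α)) ^ 2 / (4 * u) -
        -(z - (x - 2 * (t ^ 2 / u) * α)) ^ 2 / (4 * (t ^ 2 / u)) =
        (4 * α ^ 2 * t ^ 2 - (z - x) ^ 2) * (t ^ 2 - u ^ 2) / (4 * u * t ^ 2) := by
      field_simp
      ring
    have h1 : 0 ≤ 4 * α ^ 2 * t ^ 2 - (z - x) ^ 2 := by linarith
    have h2 : 0 ≤ t ^ 2 - u ^ 2 := by nlinarith
    have : 0 ≤ (4 * α ^ 2 * t ^ 2 - (z - x) ^ 2) * (t ^ 2 - u ^ 2) / (4 * u * t ^ 2) := by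
      positivity
    linarith
  unfold pk1 gauss1
  rw [← mul_assoc, hpow]
  gcongr

/-- The map `u ↦ t ^ 2 / u` sends `(0, t)` onto `(t, ∞)`. -/
lemma image_sq_div_Ioo {t : ℝ} (ht : 0 < t) :
    (fun u : ℝ => t ^ 2 / u) '' Set.Ioo 0 t = Set.Ioi t := by
  ext s
  simp only [Set.mem_image, Set.mem_Ioo, Set.mem_Ioi]
  constructor
  · rintro ⟨u, ⟨hu, hut⟩, rfl⟩
    rw [lt_div_iff₀ hu]
    nlinarith
  · intro hs
    have hs0 : 0 < s := ht.trans hs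
    refine ⟨t ^ 2 / s, ⟨by positivity, ?_⟩, by field_simp⟩
    rw [div_lt_iff₀ hs0]
    nlinarith

/-- Change of variables `s = t ^ 2 / u` from `(t, ∞)` to `(0, t)`. -/
lemma lintegral_Ioi_eq_lintegral_Ioo_sq_div {t : ℝ} (ht : 0 < t) (f : ℝ → ℝ≥0∞) :
    ∫⁻ s in Set.Ioi t, f s =
      ∫⁻ u in Set.Ioo 0 t, ENNReal.ofReal (t ^ 2 / u ^ 2) * f (t ^ 2 / u) := by
  have hderiv : ∀ u ∈ Set.Ioo 0 t,
      HasDerivWithinAt (fun u : ℝ => t ^ 2 / u) (-(t ^ 2 / u ^ 2)) (Set.Ioo 0 t) u := by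
    intro u hu
    have := ((hasDerivAt_inv hu.1.ne').const_mul (t ^ 2)).hasDerivWithinAt (s := Set.Ioo 0 t)
    simpa [div_eq_mul_inv] using this
  have hinj : Set.InjOn (fun u : ℝ => t ^ 2 / u) (Set.Ioo 0 t) := by
    intro u hu v hv huv
    have hu0 := hu.1.ne'
    have hv0 := hv.1.ne'
    have ht0 := ht.ne'
    dsimp only at huv
    field_simp at huv
    exact huv.symm
  rw [← image_sq_div_Ioo ht,
    lintegral_image_eq_lintegral_abs_deriv_mul measurableSet_Ioo hderiv hinj]
  refine setLIntegral_congr_fun measurableSet_Ioo fun u _ => ?_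
  simp only [abs_neg]
  rw [abs_of_nonneg (by positivity)]

/-- The tail of the exponentially damped potential is dominated by the truncated potential. -/
lemma lintegral_Ioi_exp_mul_pk1_le {t α x z : ℝ} (ht : 0 < t) (h : |z - x| ≤ 2 * |α| * t) :
    ∫⁻ s in Set.Ioi t, ENNReal.ofReal (Real.exp (-s / t) * pk1 α s x z) ≤
      ENNReal.ofReal (Real.exp (-1)) *
        ∫⁻ s in Set.Ioo (0 : ℝ) t, ENNReal.ofReal (pk1 α s x z) := by
  rw [lintegral_Ioi_eq_lintegral_Ioo_sq_div ht, ← lintegral_const_mul' _ _ ENNReal.ofReal_ne_top]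
  refine setLIntegral_mono' measurableSet_Ioo fun u hu => ?_
  have hu0 := hu.1
  rw [← ENNReal.ofReal_mul (by positivity), ← ENNReal.ofReal_mul (by positivity)]
  apply ENNReal.ofReal_le_ofReal
  have hdamp : t / u * Real.exp (-(t ^ 2 / u) / t) ≤ Real.exp (-1) := by
    have e : -(t ^ 2 / u) / t = -1 - (t / u - 1) := by
      field_simp
      ring
    have hle : t / u ≤ Real.exp (t / u - 1) := by
      linarith [Real.add_one_le_exp (t / u - 1)]
    rw [e, Real.exp_sub, ← mul_div_assoc, div_le_iff₀ (Real.exp_pos _), mul_comm]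
    gcongr
  have hnn := pk1_nonneg (show 0 < t ^ 2 / u by positivity) α x z
  calc t ^ 2 / u ^ 2 * (Real.exp (-(t ^ 2 / u) / t) * pk1 α (t ^ 2 / u) x z)
      = (t / u * Real.exp (-(t ^ 2 / u) / t)) * (t / u * pk1 α (t ^ 2 / u) x z) := by ring
    _ ≤ Real.exp (-1) * pk1 α u x z :=
        mul_le_mul hdamp (pk1_reflect_le hu0 hu.2.le h) (by positivity) (by positivity)

theorem stmt15 (t : ℝ) (ht : 0 < t) (α x z : ℝ) (h : |z - x| ≤ 2 * |α| * t) :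
    ENNReal.ofReal (Real.exp 1 / (Real.exp 1 + 1)) *
        (∫⁻ s in Set.Ioi (0 : ℝ), ENNReal.ofReal (Real.exp (-s / t) * pk1 α s x z)) ≤
      (∫⁻ s in Set.Ioo (0 : ℝ) t, ENNReal.ofReal (pk1 α s x z)) ∧
    (∫⁻ s in Set.Ioo (0 : ℝ) t, ENNReal.ofReal (pk1 α s x z)) ≤
      ENNReal.ofReal (Real.exp 1) *
        ∫⁻ s in Set.Ioi (0 : ℝ), ENNReal.ofReal (Real.exp (-s / t) * pk1 α s x z) := by
  constructor
  · have hnear : ∫⁻ s in Set.Ioc (0 : ℝ) t, ENNReal.ofReal (Real.exp (-s / t) * pk1 α s x z) ≤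
        ∫⁻ s in Set.Ioo (0 : ℝ) t, ENNReal.ofReal (pk1 α s x z) := by
      rw [setLIntegral_congr Ioo_ae_eq_Ioc.symm]
      refine setLIntegral_mono' measurableSet_Ioo fun s hs => ENNReal.ofReal_le_ofReal ?_
      refine mul_le_of_le_one_left (pk1_nonneg hs.1 α x z) (Real.exp_le_one_iff.2 ?_)
      exact div_nonpos_of_nonpos_of_nonneg (neg_nonpos.2 hs.1.le) ht.le
    have hconst : ENNReal.ofReal (Real.exp 1 / (Real.exp 1 + 1)) *
        (1 + ENNReal.ofReal (Real.exp (-1))) = 1 := by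
      rw [← ENNReal.ofReal_one, ← ENNReal.ofReal_add zero_le_one (Real.exp_pos _).le,
        ← ENNReal.ofReal_mul (by positivity), Real.exp_neg]
      congr 1
      field_simp
    rw [← Set.Ioc_union_Ioi_eq_Ioi ht.le,
      lintegral_union measurableSet_Ioi (Set.Ioc_disjoint_Ioi le_rfl)]
    refine (mul_le_mul_right (add_le_add hnear (lintegral_Ioi_exp_mul_pk1_le ht h)) _).trans ?_
    rw [← one_add_mul, ← mul_assoc, hconst, one_mul]
  · rw [← lintegral_const_mul' _ _ ENNReal.ofReal_ne_top]
    refine le_trans ?_ (lintegral_mono_set (Set.Ioo_subset_Ioi_self : Set.Ioo 0 t ⊆ Set.Ioi 0))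
    refine setLIntegral_mono' measurableSet_Ioo fun s hs => ?_
    rw [← ENNReal.ofReal_mul (Real.exp_pos _).le, ← mul_assoc, ← Real.exp_add]
    refine ENNReal.ofReal_le_ofReal
      (le_mul_of_one_le_left (pk1_nonneg hs.1 α x z) (Real.one_le_exp ?_))
    have : s / t ≤ 1 := (div_le_one ht).2 hs.2.le
    rw [neg_div]
    linarith
end

section
/- In ℝ³, write points as z = (z₁, 𝐳₂) with z₁ ∈ ℝ and 𝐳₂ ∈ ℝ². For r > 0 let C_r = [0, 1/4] × D_r, where D_r is the closed 2-dimensional ball of radius r centred at 0, and for r ∈ (0, e^{-1}) set ϱ(r) = 1 / (r² |ln r| ln|ln r|) and U_r(z) = ϱ(r) · 1_{C_r}(z). Then lim_{ε→0⁺} sup_{x∈ℝ³, r∈(0,1/5)} ∫_{|z-x| < ε} U_r(z) / |z-x| dz = 0. -/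
open MeasureTheory Filter
open scoped ENNReal

/-- The cylinder `C_r = [0,1/4] × D_r ⊂ ℝ³`, where `D_r` is the closed 2-dimensional
ball of radius `r` centred at `0`. -/
def cylC (r : ℝ) : Set (EuclideanSpace ℝ (Fin 3)) :=
  {z | z 0 ∈ Set.Icc (0 : ℝ) (1 / 4) ∧ Real.sqrt ((z 1) ^ 2 + (z 2) ^ 2) ≤ r}

/-- `ϱ(r) = 1 / (r² |ln r| ln |ln r|)`. -/
noncomputable def varrho (r : ℝ) : ℝ :=
  1 / (r ^ 2 * |Real.log r| * Real.log |Real.log r|)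

/-- `U_r(z) = ϱ(r) 1_{C_r}(z)`. -/
noncomputable def Ur (r : ℝ) (z : EuclideanSpace ℝ (Fin 3)) : ℝ :=
  Set.indicator (cylC r) (fun _ => varrho r) z
/-- In polar coordinates, the Newtonian kernel on a ball of radius `ρ` has mass of order `ρ ^ 2`. -/
lemma lintegral_one_div_norm_sub_ball (x : EuclideanSpace ℝ (Fin 3)) {ρ : ℝ} (hρ : 0 < ρ) :
    ∫⁻ z in {z : EuclideanSpace ℝ (Fin 3) | ‖z - x‖ < ρ}, ENNReal.ofReal (1 / ‖z - x‖) =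
      ENNReal.ofReal
        (3 / 2 * volume.real (Metric.ball (0 : EuclideanSpace ℝ (Fin 3)) 1) * ρ ^ 2) := by
  set f : ℝ → ℝ := (Set.Iio ρ).indicator fun y => 1 / y with hf
  have hpow : Set.EqOn (fun y : ℝ => y ^ (Module.finrank ℝ (EuclideanSpace ℝ (Fin 3)) - 1) • f y)
      ((Set.Ioo 0 ρ).indicator id) (Set.Ioi 0) := by
    intro y (hy : 0 < y)
    by_cases hyρ : y < ρ
    · simp [hf, hyρ, hy]
      field_simp
    · simp [hf, hyρ]
  have hid : IntegrableOn (id : ℝ → ℝ) (Set.Ioo 0 ρ) :=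
    (continuous_id.integrableOn_Icc).mono_set Set.Ioo_subset_Icc_self
  have hint : Integrable fun z : EuclideanSpace ℝ (Fin 3) => f ‖z‖ := by
    rw [integrable_fun_norm_addHaar, integrableOn_congr_fun hpow measurableSet_Ioi]
    exact (hid.integrable_indicator measurableSet_Ioo).integrableOn
  have hval : ∫ z : EuclideanSpace ℝ (Fin 3), f ‖z‖ =
      3 / 2 * volume.real (Metric.ball (0 : EuclideanSpace ℝ (Fin 3)) 1) * ρ ^ 2 := by
    rw [integral_fun_norm_addHaar, setIntegral_congr_fun measurableSet_Ioi hpow,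
      setIntegral_indicator measurableSet_Ioo,
      Set.inter_eq_self_of_subset_right Set.Ioo_subset_Ioi_self, ← integral_Ioc_eq_integral_Ioo,
      ← intervalIntegral.integral_of_le hρ.le]
    simp
    ring
  have hmeas : MeasurableSet {z : EuclideanSpace ℝ (Fin 3) | ‖z - x‖ < ρ} :=
    measurableSet_lt (by fun_prop) (by fun_prop)
  rw [← hval, ofReal_integral_eq_lintegral_ofReal hint
    (.of_forall fun z => Set.indicator_apply_nonneg fun _ => by simp), ← lintegral_indicator hmeas,
    ← lintegral_sub_right_eq_self (fun z => ENNReal.ofReal (f ‖z‖)) x]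
  refine lintegral_congr fun z => ?_
  by_cases hz : ‖z - x‖ < ρ <;> simp [hf, hz]

lemma lintegral_one_div_max_abs_le {r : ℝ} (hr : 0 < r) (hr1 : r < 1) :
    ∫⁻ t in Set.Ioo (-1 : ℝ) 1, ENNReal.ofReal (1 / max r |t|) ≤
      ENNReal.ofReal (2 - 2 * Real.log r) := by
  have hc : Continuous fun t : ℝ => 1 / max r |t| := by
    refine continuous_const.div (by fun_prop) fun t => (lt_max_of_lt_left hr).ne'
  have hii : ∀ a b : ℝ, IntervalIntegrable (fun t : ℝ => 1 / max r |t|) volume a b :=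
    fun a b => hc.intervalIntegrable a b
  have hright : ∫ t in r..1, 1 / max r |t| = -Real.log r := by
    rw [intervalIntegral.integral_congr (g := fun t => 1 / t)]
    · rw [integral_one_div_of_pos hr one_pos]
      simp
    · intro t ht
      rw [Set.uIcc_of_le hr1.le] at ht
      simp only
      rw [abs_of_pos (hr.trans_le ht.1), max_eq_right ht.1]
  have hleft : ∫ t in (-1 : ℝ)..(-r), 1 / max r |t| = -Real.log r := by
    rw [← hright, ← intervalIntegral.integral_comp_neg]
    simp
  have hmid : ∫ t in (-r)..r, 1 / max r |t| = 2 := by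
    rw [intervalIntegral.integral_congr (g := fun _ => 1 / r)]
    · simp
      field_simp
      norm_num
    · intro t ht
      rw [Set.uIcc_of_le (by linarith)] at ht
      simp only
      rw [max_eq_left (abs_le.2 ht)]
  rw [← ofReal_integral_eq_lintegral_ofReal
    (hc.integrableOn_Icc.mono_set Set.Ioo_subset_Icc_self)
    (.of_forall fun t => one_div_nonneg.2 (le_max_of_le_left hr.le)),
    ← integral_Ioc_eq_integral_Ioo, ← intervalIntegral.integral_of_le (by norm_num),
    ← intervalIntegral.integral_add_adjacent_intervals (hii _ r) (hii r _),
    ← intervalIntegral.integral_add_adjacent_intervals (hii _ (-r)) (hii (-r) _),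
    hleft, hmid, hright]
  exact ENNReal.ofReal_le_ofReal (by linarith)

lemma measurableSet_cylC (r : ℝ) : MeasurableSet (cylC r) :=
  (measurableSet_Icc.preimage (f := fun z : EuclideanSpace ℝ (Fin 3) => z 0) (by fun_prop)).inter
    (measurableSet_le
      (f := fun z : EuclideanSpace ℝ (Fin 3) => Real.sqrt ((z 1) ^ 2 + (z 2) ^ 2))
      (by fun_prop) measurable_const)

lemma lintegral_one_div_norm_sub_cylC_le (x : EuclideanSpace ℝ (Fin 3)) {r : ℝ} (hr : 0 < r)
    (hr1 : r < 1) :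
    ∫⁻ z in {z : EuclideanSpace ℝ (Fin 3) | z ∈ cylC r ∧ r ≤ ‖z - x‖ ∧ ‖z - x‖ < 1},
        ENNReal.ofReal (1 / ‖z - x‖) ≤
      ENNReal.ofReal ((2 - 2 * Real.log r) * (2 * r) ^ 2) := by
  set g : ℝ → ℝ≥0∞ := (Set.Ioo (-1 : ℝ) 1).indicator fun t => ENNReal.ofReal (1 / max r |t|)
    with hg
  set k : (Fin 2 → ℝ) → ℝ≥0∞ := (Set.univ.pi fun _ => Set.Icc (-r) r).indicator 1 with hk
  have hgm : Measurable g := by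
    refine Measurable.indicator ?_ measurableSet_Ioo
    fun_prop
  have hkm : Measurable k :=
    measurable_one.indicator (MeasurableSet.univ_pi fun _ => measurableSet_Icc)
  have hmeas : MeasurableSet
      {z : EuclideanSpace ℝ (Fin 3) | z ∈ cylC r ∧ r ≤ ‖z - x‖ ∧ ‖z - x‖ < 1} :=
    (measurableSet_cylC r).inter
      (measurableSet_Ico.preimage (f := fun z : EuclideanSpace ℝ (Fin 3) => ‖z - x‖) (by fun_prop))
  have hmp := (volume_preserving_piFinSuccAbove (fun _ : Fin 3 => ℝ) 0).comp
    (PiLp.volume_preserving_ofLp (Fin 3))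
  calc
    _ = ∫⁻ z, {z : EuclideanSpace ℝ (Fin 3) | z ∈ cylC r ∧ r ≤ ‖z - x‖ ∧ ‖z - x‖ < 1}.indicator
          (fun z => ENNReal.ofReal (1 / ‖z - x‖)) z := (lintegral_indicator hmeas _).symm
    _ ≤ ∫⁻ z : EuclideanSpace ℝ (Fin 3), g (z 0 - x 0) * k (fun i => z i.succ) := by
      refine lintegral_mono fun z => Set.indicator_apply_le' (fun hz => ?_) fun _ => zero_le
      obtain ⟨⟨-, hz⟩, hzr, hz1⟩ := hz
      have h0 : |z 0 - x 0| ≤ ‖z - x‖ := by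
        simpa using PiLp.norm_apply_le (z - x) 0
      have hkz : k (fun i => z i.succ) = 1 := by
        have h1 := (Real.abs_le_sqrt (show (z 1) ^ 2 ≤ (z 1) ^ 2 + (z 2) ^ 2 by
          nlinarith [sq_nonneg (z 2)])).trans hz
        have h2 := (Real.abs_le_sqrt (show (z 2) ^ 2 ≤ (z 1) ^ 2 + (z 2) ^ 2 by
          nlinarith [sq_nonneg (z 1)])).trans hz
        rw [hk, Set.indicator_of_mem, Pi.one_apply]
        intro i _
        fin_cases i
        · exact abs_le.1 h1
        · exact abs_le.1 h2
      rw [hkz, mul_one, hg, Set.indicator_of_mem (Set.mem_Ioo.2 (abs_lt.1 (h0.trans_lt hz1)))]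
      exact ENNReal.ofReal_le_ofReal
        (one_div_le_one_div_of_le (lt_max_of_lt_left hr) (max_le hzr h0))
    _ = ∫⁻ p : ℝ × (Fin 2 → ℝ), g (p.1 - x 0) * k p.2 :=
      hmp.lintegral_comp (f := fun p : ℝ × (Fin 2 → ℝ) => g (p.1 - x 0) * k p.2) (by fun_prop)
    _ = (∫⁻ t, g (t - x 0)) * ∫⁻ w, k w :=
      lintegral_prod_mul (f := fun t => g (t - x 0)) (by fun_prop) hkm.aemeasurable
    _ = (∫⁻ t in Set.Ioo (-1 : ℝ) 1, ENNReal.ofReal (1 / max r |t|)) *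
          ENNReal.ofReal ((2 * r) ^ 2) := by
      rw [lintegral_sub_right_eq_self, hg, lintegral_indicator measurableSet_Ioo, hk,
        lintegral_indicator_one (MeasurableSet.univ_pi fun _ => measurableSet_Icc),
        volume_pi_pi]
      simp [Real.volume_Icc, ← two_mul, ENNReal.ofReal_pow hr.le, ENNReal.ofReal_mul, mul_pow]
    _ ≤ _ := by
      rw [ENNReal.ofReal_mul' (by positivity)]
      gcongr
      exact lintegral_one_div_max_abs_le hr hr1

/-- On `(0, 1/5)` both `|ln r|` and `ln |ln r|` are bounded away from zero. -/
lemma log_bounds {r s : ℝ} (hr : 0 < r) (hrs : r ≤ s) (hs : s ≤ 1 / 5) :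
    1 ≤ |Real.log r| ∧ 0 < Real.log |Real.log s| ∧
      Real.log |Real.log s| ≤ Real.log |Real.log r| := by
  have hs0 : 0 < s := hr.trans_le hrs
  have h5 : 1 < -Real.log (1 / 5) := by
    rw [one_div, Real.log_inv, neg_neg, Real.lt_log_iff_exp_lt (by norm_num)]
    exact Real.exp_one_lt_d9.trans (by norm_num)
  have h1 := Real.log_le_log hr hrs
  have h2 := Real.log_le_log hs0 hs
  rw [abs_of_neg (by linarith), abs_of_neg (by linarith)]
  exact ⟨by linarith, Real.log_pos (by linarith), Real.log_le_log (by linarith) (by linarith)⟩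

/-- A bound uniform in `x` and `r`: the first term dominates when `r < √ε`, the second one
otherwise. -/
lemma lintegral_Ur_le (x : EuclideanSpace ℝ (Fin 3)) {r ε : ℝ} (hr : 0 < r) (hr5 : r < 1 / 5)
    (hε : 0 < ε) (hε1 : √ε ≤ 1 / 5) :
    ∫⁻ z in {z : EuclideanSpace ℝ (Fin 3) | ‖z - x‖ < ε}, ENNReal.ofReal (Ur r z / ‖z - x‖) ≤
      ENNReal.ofReal
        ((3 / 2 * volume.real (Metric.ball (0 : EuclideanSpace ℝ (Fin 3)) 1) + 16) *
            (Real.log |Real.log √ε|)⁻¹ +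
          3 / 2 * volume.real (Metric.ball (0 : EuclideanSpace ℝ (Fin 3)) 1) *
            (Real.log |Real.log (1 / 5)|)⁻¹ * ε) := by
  set K := 3 / 2 * volume.real (Metric.ball (0 : EuclideanSpace ℝ (Fin 3)) 1)
  have hK : 0 ≤ K := by positivity
  have hsε : 0 < √ε := Real.sqrt_pos.2 hε
  obtain ⟨hl1, hL5, hL5r⟩ := log_bounds hr hr5.le le_rfl
  obtain ⟨-, hLε, -⟩ := log_bounds hsε le_rfl hε1
  have hLr : 0 < Real.log |Real.log r| := hL5.trans_le hL5r
  have hϱ : 0 ≤ varrho r := by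
    unfold varrho
    positivity
  have hfactor : ∫⁻ z in {z : EuclideanSpace ℝ (Fin 3) | ‖z - x‖ < ε},
      ENNReal.ofReal (Ur r z / ‖z - x‖) =
      ENNReal.ofReal (varrho r) * ∫⁻ z in cylC r ∩ {z | ‖z - x‖ < ε},
        ENNReal.ofReal (1 / ‖z - x‖) := by
    rw [← lintegral_const_mul _ (by fun_prop), ← setLIntegral_indicator (measurableSet_cylC r)]
    refine lintegral_congr fun z => ?_
    by_cases hz : z ∈ cylC r
    · simp [Ur, hz, ← ENNReal.ofReal_mul hϱ, div_eq_mul_inv]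
    · simp [Ur, hz]
  rw [hfactor]
  obtain hrε | hrε := lt_or_ge r (√ε)
  · obtain ⟨-, -, hLεr⟩ := log_bounds hr hrε.le hε1
    have hε1' : ε < 1 := by
      rw [← Real.sq_sqrt hε.le]
      nlinarith
    have hsub : cylC r ∩ {z | ‖z - x‖ < ε} ⊆ {z | ‖z - x‖ < r} ∪
        {z | z ∈ cylC r ∧ r ≤ ‖z - x‖ ∧ ‖z - x‖ < 1} := by
      rintro z ⟨hz, hzε⟩
      obtain h | h := lt_or_ge ‖z - x‖ r
      · exact .inl h
      · exact .inr ⟨hz, h, lt_trans hzε hε1'⟩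
    calc
      _ ≤ ENNReal.ofReal (varrho r) *
          (ENNReal.ofReal (K * r ^ 2) + ENNReal.ofReal ((2 - 2 * Real.log r) * (2 * r) ^ 2)) := by
        gcongr
        refine (lintegral_mono_set hsub).trans ((lintegral_union_le _ _ _).trans ?_)
        exact add_le_add (lintegral_one_div_norm_sub_ball x hr).le
          (lintegral_one_div_norm_sub_cylC_le x hr (by linarith))
      _ ≤ ENNReal.ofReal (varrho r) * ENNReal.ofReal ((K + 16) * (r ^ 2 * |Real.log r|)) := by
        have hlog : |Real.log r| = -Real.log r :=
          abs_of_neg (Real.log_neg hr (by linarith))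
        rw [hlog] at hl1 ⊢
        rw [← ENNReal.ofReal_add (by positivity)
          (mul_nonneg (by linarith) (by positivity))]
        gcongr
        nlinarith [mul_nonneg (mul_nonneg hK (sq_nonneg r)) (sub_nonneg.2 hl1),
          mul_nonneg (sq_nonneg r) (sub_nonneg.2 hl1)]
      _ = ENNReal.ofReal ((K + 16) * (Real.log |Real.log r|)⁻¹) := by
        rw [← ENNReal.ofReal_mul hϱ]
        congr 1
        unfold varrho
        have : |Real.log r| ≠ 0 := by positivity
        field_simp
      _ ≤ _ := by
        refine ENNReal.ofReal_le_ofReal (le_add_of_le_of_nonneg ?_ (by positivity))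
        gcongr
  · have hεr : ε ≤ r ^ 2 := by
      rw [← Real.sq_sqrt hε.le]
      gcongr
    calc
      _ ≤ ENNReal.ofReal (varrho r) * ENNReal.ofReal (K * ε ^ 2) := by
        rw [← lintegral_one_div_norm_sub_ball x hε]
        gcongr
        exact Set.inter_subset_right
      _ = ENNReal.ofReal (varrho r * (K * ε ^ 2)) := (ENNReal.ofReal_mul hϱ).symm
      _ ≤ _ := by
        refine ENNReal.ofReal_le_ofReal (le_add_of_nonneg_of_le (by positivity) ?_)
        calc
          varrho r * (K * ε ^ 2) ≤
              1 / (ε * 1 * Real.log |Real.log (1 / 5)|) * (K * ε ^ 2) := by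
            unfold varrho
            gcongr
          _ = _ := by field_simp

theorem stmt17 :
    Tendsto
      (fun ε : ℝ => ⨆ x : EuclideanSpace ℝ (Fin 3), ⨆ r ∈ Set.Ioo (0 : ℝ) (1 / 5),
        ∫⁻ z in {z : EuclideanSpace ℝ (Fin 3) | ‖z - x‖ < ε},
          ENNReal.ofReal (Ur r z / ‖z - x‖))
      (nhdsWithin 0 (Set.Ioi 0)) (nhds 0) := by
  set K := 3 / 2 * volume.real (Metric.ball (0 : EuclideanSpace ℝ (Fin 3)) 1)
  have hsqrt : Tendsto (fun ε : ℝ => √ε) (nhdsWithin 0 (Set.Ioi 0)) (nhdsWithin 0 (Set.Ioi 0)) := by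
    refine tendsto_nhdsWithin_iff.2 ⟨?_, ?_⟩
    · simpa using (Real.continuous_sqrt.tendsto 0).mono_left nhdsWithin_le_nhds
    · filter_upwards [self_mem_nhdsWithin] with ε hε using Real.sqrt_pos.2 hε
  have hlog : Tendsto (fun ε : ℝ => (Real.log |Real.log √ε|)⁻¹) (nhdsWithin 0 (Set.Ioi 0))
      (nhds 0) :=
    (Real.tendsto_log_atTop.comp
      (tendsto_abs_atBot_atTop.comp (Real.tendsto_log_nhdsGT_zero.comp hsqrt))).inv_tendsto_atTop
  have hid : Tendsto (fun ε : ℝ => ε) (nhdsWithin 0 (Set.Ioi 0)) (nhds 0) :=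
    tendsto_id.mono_left nhdsWithin_le_nhds
  have hbound : Tendsto (fun ε : ℝ => ENNReal.ofReal ((K + 16) * (Real.log |Real.log √ε|)⁻¹ +
      K * (Real.log |Real.log (1 / 5)|)⁻¹ * ε)) (nhdsWithin 0 (Set.Ioi 0)) (nhds 0) := by
    simpa using ENNReal.tendsto_ofReal ((hlog.const_mul (K + 16)).add
      (hid.const_mul (K * (Real.log |Real.log (1 / 5)|)⁻¹)))
  refine tendsto_of_tendsto_of_tendsto_of_le_of_le' tendsto_const_nhds hbound
    (.of_forall fun _ => zero_le) ?_
  filter_upwards [self_mem_nhdsWithin,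
    (tendsto_nhds_of_tendsto_nhdsWithin hsqrt).eventually_le_const
      (show (0 : ℝ) < 1 / 5 by norm_num)] with ε hε hε1
  exact iSup_le fun x => iSup₂_le fun r hr => lintegral_Ur_le x hr.1 hr.2 hε hε1
end

section
/- Let d = 2. For r ≥ 2 let D_r = {z ∈ ℝ² : z₁ ≥ 0 and 2 ≤ |z| ≤ r}, and for z ∈ ℝ² let K(1, z, (r,0)) = exp(-(r|z| - r z₁)/2) · log(1 + 1/√(r|z|)) · 1_{|z| ≤ r}. Then there exists a constant c > 0 such that for every Borel measurable U : ℝ² → [0,∞] and every r ≥ 2, ∫_{D_r} K(1, z, (r,0)) · U(z) dz ≤ c · sup_{w∈ℝ²} ∫_{|z| ≤ 2} U(z + w) dz. -/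
open MeasureTheory Filter
open scoped ENNReal

/-- `D_r = {z ∈ ℝ² : z₁ ≥ 0 and 2 ≤ |z| ≤ r}`. -/
def Dset (r : ℝ) : Set (EuclideanSpace ℝ (Fin 2)) :=
  {z | 0 ≤ z 0 ∧ 2 ≤ ‖z‖ ∧ ‖z‖ ≤ r}

/-- `K(1, z, (r,0)) = exp(-(r|z| - r z₁)/2) · log(1 + 1/√(r|z|)) · 1_{|z| ≤ r}`. -/
noncomputable def Ker (r : ℝ) (z : EuclideanSpace ℝ (Fin 2)) : ℝ :=
  if ‖z‖ ≤ r then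
    Real.exp (-(r * ‖z‖ - r * z 0) / 2) * Real.log (1 + 1 / Real.sqrt (r * ‖z‖))
  else 0

theorem sum_one_div_sqrt_succ_le (N : ℕ) :
    ∑ i ∈ Finset.range N, 1 / √((i : ℝ) + 1) ≤ 2 * √(N : ℝ) := by
  induction N with
  | zero => simp
  | succ k ih =>
    rw [Finset.sum_range_succ]
    have hk : (0 : ℝ) ≤ k := k.cast_nonneg
    have hpos : 0 < √((k : ℝ) + 1) := Real.sqrt_pos.2 (by linarith)
    have h1 : √((k : ℝ) + 1) ^ 2 = k + 1 := Real.sq_sqrt (by linarith)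
    have h0 : √(k : ℝ) ^ 2 = k := Real.sq_sqrt hk
    have key : 1 / √((k : ℝ) + 1) ≤ 2 * √((k : ℝ) + 1) - 2 * √(k : ℝ) := by
      rw [div_le_iff₀ hpos]
      nlinarith [sq_nonneg (√((k : ℝ) + 1) - √(k : ℝ))]
    push_cast
    linarith

theorem norm_sq_eq_fin_two (z : EuclideanSpace ℝ (Fin 2)) : ‖z‖ ^ 2 = z 0 ^ 2 + z 1 ^ 2 := by
  simp [EuclideanSpace.norm_sq_eq]

theorem exp_neg_sq_div_four_le {x : ℝ} {m : ℕ} (hm : (m : ℝ) ≤ |x|) :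
    Real.exp (-(x ^ 2 / 4)) ≤ 3 * (1 / 2) ^ m := by
  have h1 : -(x ^ 2 / 4) ≤ 1 + m * (-1 : ℝ) := by
    rw [← sq_abs x]
    nlinarith [sq_nonneg (|x| - 2)]
  have h2 : Real.exp (-1) ≤ 1 / 2 := by
    rw [Real.exp_neg, one_div]
    exact inv_anti₀ (by norm_num) (by linarith [Real.exp_one_gt_d9])
  calc Real.exp (-(x ^ 2 / 4)) ≤ Real.exp (1 + m * (-1 : ℝ)) := Real.exp_le_exp.2 h1
    _ = Real.exp 1 * Real.exp (-1) ^ m := by rw [Real.exp_add, Real.exp_nat_mul]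
    _ ≤ 3 * (1 / 2) ^ m := by
      gcongr
      linarith [Real.exp_one_lt_d9]

theorem Ker_le_of_mem_Dset {r : ℝ} (hr : 2 ≤ r) {z : EuclideanSpace ℝ (Fin 2)}
    (hz : z ∈ Dset r) {n m : ℕ} (hn : (n : ℝ) ≤ z 0) (hm : (m : ℝ) ≤ |z 1|) :
    Ker r z ≤ 3 * (√2 / √r) * (1 / √((n : ℝ) + 1)) * (1 / 2) ^ m := by
  obtain ⟨h0, h2, hzr⟩ := hz
  have hsq := norm_sq_eq_fin_two z
  have hle : z 0 ≤ ‖z‖ := by nlinarith [sq_nonneg (z 1)]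
  have hexp : -(r * ‖z‖ - r * z 0) / 2 ≤ -(z 1 ^ 2 / 4) := by
    have : z 1 ^ 2 ≤ 2 * (r * (‖z‖ - z 0)) := by
      nlinarith [mul_nonneg (sub_nonneg.2 hzr) (sub_nonneg.2 hle)]
    linarith
  have hlog : Real.log (1 + 1 / √(r * ‖z‖)) ≤ √2 / √r * (1 / √((n : ℝ) + 1)) := by
    have hn0 : (0 : ℝ) ≤ n := n.cast_nonneg
    have hpos : 0 < 1 / √(r * ‖z‖) := one_div_pos.2 (Real.sqrt_pos.2 (by nlinarith))
    have hlog' := Real.log_le_sub_one_of_pos (show 0 < 1 + 1 / √(r * ‖z‖) by linarith)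
    refine (show _ ≤ 1 / √(r * ‖z‖) by linarith).trans ?_
    have h3 : √((n : ℝ) + 1) ≤ √2 * √‖z‖ := by
      rw [← Real.sqrt_mul (by norm_num)]
      exact Real.sqrt_le_sqrt (by linarith)
    have hr0 : 0 < √r := Real.sqrt_pos.2 (by linarith)
    have hz0 : 0 < √‖z‖ := Real.sqrt_pos.2 (by linarith)
    have hn1 : 0 < √((n : ℝ) + 1) := Real.sqrt_pos.2 (by linarith)
    rw [Real.sqrt_mul (by linarith), div_mul_div_comm, mul_one,
      div_le_div_iff₀ (by positivity) (by positivity)]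
    nlinarith
  have hlog0 : 0 ≤ Real.log (1 + 1 / √(r * ‖z‖)) :=
    Real.log_nonneg (le_add_of_nonneg_right (by positivity))
  rw [Ker, if_pos hzr]
  calc _ ≤ 3 * (1 / 2) ^ m * (√2 / √r * (1 / √((n : ℝ) + 1))) :=
        mul_le_mul ((Real.exp_le_exp.2 hexp).trans (exp_neg_sq_div_four_le hm)) hlog hlog0
          (by positivity)
    _ = _ := by ring

theorem setLIntegral_closedBall_le_iSup (U : EuclideanSpace ℝ (Fin 2) → ℝ≥0∞) (R : ℝ)
    (p : EuclideanSpace ℝ (Fin 2)) :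
    ∫⁻ z in Metric.closedBall p R, U z ≤
      ⨆ w : EuclideanSpace ℝ (Fin 2), ∫⁻ z in Metric.closedBall 0 R, U (z + w) := by
  refine le_trans (le_of_eq ?_) (le_iSup _ p)
  rw [← (measurePreserving_add_right volume p).setLIntegral_comp_preimage_emb
    (measurableEmbedding_addRight p) U]
  simp

theorem mem_closedBall_two_of_coord {z : EuclideanSpace ℝ (Fin 2)} {a b : ℝ}
    (ha : |z 0 - a| ≤ 1) (hb : |z 1 - b| ≤ 1) : z ∈ Metric.closedBall !₂[a, b] 2 := by
  rw [mem_closedBall_iff_norm]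
  have h := norm_sq_eq_fin_two (z - !₂[a, b])
  simp only [PiLp.sub_apply, Matrix.cons_val_zero, Matrix.cons_val_one] at h
  have h1 := (sq_le_one_iff_abs_le_one _).2 ha
  have h2 := (sq_le_one_iff_abs_le_one _).2 hb
  exact abs_le_of_sq_le_sq' (by linarith) (by norm_num) |>.2

/-- The part of `Dset r` in the unit cell with corner `(n, m)` and its mirror image in the first
axis. -/
def DsetCell (r : ℝ) (n m : ℕ) : Set (EuclideanSpace ℝ (Fin 2)) :=
  {z | z ∈ Dset r ∧ (n : ℝ) ≤ z 0 ∧ z 0 ≤ n + 1 ∧ (m : ℝ) ≤ |z 1| ∧ |z 1| ≤ m + 1}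

theorem Dset_subset_iUnion_DsetCell (r : ℝ) :
    Dset r ⊆ ⋃ p : Fin (⌊r⌋₊ + 1) × ℕ, DsetCell r p.1 p.2 := by
  intro z hz
  have hsq := norm_sq_eq_fin_two z
  have hle : z 0 ≤ r := le_trans (by nlinarith [sq_nonneg (z 1), norm_nonneg z]) hz.2.2
  refine Set.mem_iUnion.2 ⟨(⟨⌊z 0⌋₊, Nat.lt_succ_of_le (Nat.floor_le_floor hle)⟩, ⌊|z 1|⌋₊),
    hz, Nat.floor_le hz.1, (Nat.lt_floor_add_one _).le, Nat.floor_le (abs_nonneg _),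
    (Nat.lt_floor_add_one _).le⟩

theorem DsetCell_subset_closedBall_union (r : ℝ) (n m : ℕ) :
    DsetCell r n m ⊆
      Metric.closedBall !₂[(n : ℝ), (m : ℝ)] 2 ∪ Metric.closedBall !₂[(n : ℝ), -(m : ℝ)] 2 := by
  rintro z ⟨-, h1, h2, h3, h4⟩
  have ha : |z 0 - n| ≤ 1 := abs_le.2 ⟨by linarith, by linarith⟩
  rcases abs_cases (z 1) with h | h
  · exact Or.inl (mem_closedBall_two_of_coord ha (abs_le.2 ⟨by linarith, by linarith⟩))
  · exact Or.inr (mem_closedBall_two_of_coord ha (abs_le.2 ⟨by linarith, by linarith⟩))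

theorem setLIntegral_DsetCell_le {U : EuclideanSpace ℝ (Fin 2) → ℝ≥0∞} (hU : Measurable U)
    {r : ℝ} (hr : 2 ≤ r) (n m : ℕ) :
    ∫⁻ z in DsetCell r n m, ENNReal.ofReal (Ker r z) * U z ≤
      ENNReal.ofReal (3 * (√2 / √r) * (1 / √((n : ℝ) + 1))) * 2⁻¹ ^ m *
        (2 * ⨆ w : EuclideanSpace ℝ (Fin 2),
          ∫⁻ z in Metric.closedBall (0 : EuclideanSpace ℝ (Fin 2)) 2, U (z + w)) := by
  have hpow : (2⁻¹ : ℝ≥0∞) ^ m = ENNReal.ofReal ((1 / 2) ^ m) := by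
    rw [ENNReal.ofReal_pow (by norm_num), one_div, ENNReal.ofReal_inv_of_pos (by norm_num)]
    simp
  rw [hpow, ← ENNReal.ofReal_mul (by positivity)]
  refine (setLIntegral_mono (hU.const_mul _) fun z hz => mul_le_mul_left
    (ENNReal.ofReal_le_ofReal (Ker_le_of_mem_Dset hr hz.1 hz.2.1 hz.2.2.2.1)) _).trans ?_
  rw [lintegral_const_mul _ hU]
  gcongr
  refine (lintegral_mono_set (DsetCell_subset_closedBall_union r n m)).trans
    ((lintegral_union_le _ _ _).trans ?_)
  rw [two_mul]
  exact add_le_add (setLIntegral_closedBall_le_iSup U 2 _) (setLIntegral_closedBall_le_iSup U 2 _)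

theorem sum_cell_weights_le {r : ℝ} (hr : 2 ≤ r) :
    ∑ n ∈ Finset.range (⌊r⌋₊ + 1), 3 * (√2 / √r) * (1 / √((n : ℝ) + 1)) ≤ 12 := by
  have hr0 : 0 < √r := Real.sqrt_pos.2 (by linarith)
  have h1 : √((⌊r⌋₊ + 1 : ℕ) : ℝ) ≤ √2 * √r := by
    rw [← Real.sqrt_mul (by norm_num)]
    have := Nat.floor_le (show 0 ≤ r by linarith)
    exact Real.sqrt_le_sqrt (by push_cast; linarith)
  rw [← Finset.mul_sum]
  calc _ ≤ 3 * (√2 / √r) * (2 * (√2 * √r)) := by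
        gcongr
        exact (sum_one_div_sqrt_succ_le _).trans (by gcongr)
    _ = 6 * √2 ^ 2 := by field_simp; ring
    _ = 12 := by rw [Real.sq_sqrt (by norm_num)]; norm_num

theorem tsum_cell_weights_le {r : ℝ} (hr : 2 ≤ r) :
    ∑' p : Fin (⌊r⌋₊ + 1) × ℕ,
      ENNReal.ofReal (3 * (√2 / √r) * (1 / √(((p.1 : ℕ) : ℝ) + 1))) * (2⁻¹ : ℝ≥0∞) ^ p.2 ≤ 24 := by
  rw [ENNReal.tsum_prod (f := fun (n : Fin (⌊r⌋₊ + 1)) (m : ℕ) =>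
    ENNReal.ofReal (3 * (√2 / √r) * (1 / √(((n : ℕ) : ℝ) + 1))) * (2⁻¹ : ℝ≥0∞) ^ m)]
  simp_rw [ENNReal.tsum_mul_left]
  rw [ENNReal.tsum_mul_right, tsum_fintype, Fin.sum_univ_eq_sum_range
    (fun n : ℕ => ENNReal.ofReal (3 * (√2 / √r) * (1 / √((n : ℝ) + 1)))),
    ← ENNReal.ofReal_sum_of_nonneg fun _ _ => by positivity, ENNReal.tsum_geometric,
    ENNReal.one_sub_inv_two, inv_inv]
  calc _ ≤ ENNReal.ofReal 12 * 2 := by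
        gcongr
        exact sum_cell_weights_le hr
    _ = 24 := by
        rw [ENNReal.ofReal_ofNat]
        norm_num

theorem stmt18 :
    ∃ c : ℝ, 0 < c ∧
      ∀ U : EuclideanSpace ℝ (Fin 2) → ℝ≥0∞, Measurable U → ∀ r : ℝ, 2 ≤ r →
        (∫⁻ z in Dset r, ENNReal.ofReal (Ker r z) * U z) ≤
          ENNReal.ofReal c *
            ⨆ w : EuclideanSpace ℝ (Fin 2),
              ∫⁻ z in Metric.closedBall (0 : EuclideanSpace ℝ (Fin 2)) 2, U (z + w) := by
  refine ⟨48, by norm_num, fun U hU r hr => ?_⟩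
  set S := ⨆ w : EuclideanSpace ℝ (Fin 2),
    ∫⁻ z in Metric.closedBall (0 : EuclideanSpace ℝ (Fin 2)) 2, U (z + w)
  calc ∫⁻ z in Dset r, ENNReal.ofReal (Ker r z) * U z
      ≤ ∫⁻ z in ⋃ p : Fin (⌊r⌋₊ + 1) × ℕ, DsetCell r p.1 p.2, ENNReal.ofReal (Ker r z) * U z :=
        lintegral_mono_set (Dset_subset_iUnion_DsetCell r)
    _ ≤ ∑' p : Fin (⌊r⌋₊ + 1) × ℕ,
          ∫⁻ z in DsetCell r p.1 p.2, ENNReal.ofReal (Ker r z) * U z := lintegral_iUnion_le _ _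
    _ ≤ ∑' p : Fin (⌊r⌋₊ + 1) × ℕ,
          ENNReal.ofReal (3 * (√2 / √r) * (1 / √(((p.1 : ℕ) : ℝ) + 1))) * 2⁻¹ ^ p.2 * (2 * S) :=
        ENNReal.tsum_le_tsum fun p => setLIntegral_DsetCell_le hU hr p.1 p.2
    _ ≤ 24 * (2 * S) := by
        rw [ENNReal.tsum_mul_right]
        exact mul_le_mul_left (tsum_cell_weights_le hr) _
    _ = ENNReal.ofReal 48 * S := by
        rw [ENNReal.ofReal_ofNat, ← mul_assoc]
        norm_num
end
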